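/- arXiv:math/0209112 — 3 statements merged into one kernel-verified Lean document; each statement's English description precedes it below -/
import Mathlib

section
/- Let P ⊆ ℝⁿ be a polytope and let U be a nonempty relatively open subset of P (open in the subspace topology of P). Then there exists an admissible sequence of polytopes P = P₀, P₁, P₂, … such that P_j ⊆ U for all sufficiently large indices j. Moreover, if P is rational then all the polytopes P_j can be chosen to be rational. -/
/-! # Statement 0

Lemma (Gubeladze): for any (nonempty, relatively) open subset `U` of a polytope `P ⊆ ℝⁿ`
there exists an admissible sequence of polytopes `P = P₀, P₁, P₂, …` such that `P_j ⊆ U`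
for all sufficiently large `j`; if `P` is rational, the `P_j` can be chosen rational.
-/

open Set

/-- A polytope in `ℝⁿ`: the convex hull of a finite set of points. -/
def IsPolytope {n : ℕ} (P : Set (Fin n → ℝ)) : Prop :=
  ∃ S : Finset (Fin n → ℝ), P = convexHull ℝ (S : Set (Fin n → ℝ))

/-- The dimension of a polytope: the dimension of its affine hull. -/
noncomputable def polyDim {n : ℕ} (P : Set (Fin n → ℝ)) : ℕ :=
  Module.finrank ℝ (affineSpan ℝ P).direction

/-- A face of `P`: the intersection of `P` with the boundary hyperplane of a closed
half-space containing `P`. -/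
def IsFace {n : ℕ} (P F : Set (Fin n → ℝ)) : Prop :=
  ∃ (f : (Fin n → ℝ) →ₗ[ℝ] ℝ) (c : ℝ), f ≠ 0 ∧ (∀ x ∈ P, f x ≤ c) ∧
    F = {x ∈ P | f x = c}

/-- A vertex of `P`: a point whose singleton is a (0-dimensional) face of `P`. -/
def IsVertex {n : ℕ} (P : Set (Fin n → ℝ)) (v : Fin n → ℝ) : Prop :=
  IsFace P {v}

/-- `P` is a pyramid with apex `v` and base the facet `F`, not containing `v` in its
affine hull: `P = conv (F ∪ {v})`. -/
def IsPyramid {n : ℕ} (P : Set (Fin n → ℝ)) (v : Fin n → ℝ) (F : Set (Fin n → ℝ)) : Prop :=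
  IsPolytope P ∧ IsFace P F ∧ polyDim F = polyDim P - 1 ∧ IsVertex P v ∧
    v ∉ affineSpan ℝ F ∧ P = convexHull ℝ (F ∪ {v})

/-- `P ⊂ Q` is a pyramidal extension: `P` is obtained from `Q` by cutting off a pyramid
at a vertex `v` of `Q`. -/
def IsPyramidalExtension {n : ℕ} (P Q : Set (Fin n → ℝ)) : Prop :=
  IsPolytope P ∧ IsPolytope Q ∧ P ⊆ Q ∧ P ≠ Q ∧
  ∃ (P' : Set (Fin n → ℝ)) (v : Fin n → ℝ),
    IsPolytope P' ∧ Q = P ∪ P' ∧ polyDim P = polyDim Q ∧ polyDim P' = polyDim Q ∧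
    IsVertex Q v ∧ IsPyramid P' v (P ∩ P')

/-- An admissible sequence of polytopes for `P`: it starts at `P`, all members are
polytopes contained in `P`, and each step is either a pyramidal extension
`P_{k+1} ⊂ P_k` or an inclusion `P_k ⊆ P_{k+1}`. -/
def IsAdmissibleSeq {n : ℕ} (P : Set (Fin n → ℝ)) (Ps : ℕ → Set (Fin n → ℝ)) : Prop :=
  Ps 0 = P ∧ ∀ k : ℕ, IsPolytope (Ps k) ∧ Ps k ⊆ P ∧
    (IsPyramidalExtension (Ps (k + 1)) (Ps k) ∨ Ps k ⊆ Ps (k + 1))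

/-- A rational polytope: a polytope all of whose vertices have rational coordinates. -/
def IsRationalPolytope {n : ℕ} (P : Set (Fin n → ℝ)) : Prop :=
  IsPolytope P ∧ ∀ v : Fin n → ℝ, IsVertex P v → ∀ i : Fin n, ∃ q : ℚ, v i = (q : ℝ)

/-- Points of `ℝⁿ` with all coordinates in the subfield `K`. -/
def IsPointOver (K : Subfield ℝ) {n : ℕ} (x : Fin n → ℝ) : Prop :=
  ∀ i, x i ∈ K

/-- Linear functionals taking values in `K` at the points over `K`. -/
def IsFunctionalOver (K : Subfield ℝ) {n : ℕ} (f : (Fin n → ℝ) →ₗ[ℝ] ℝ) : Prop :=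
  ∀ x, IsPointOver K x → f x ∈ K

/-- Convex hulls of finitely many points over `K`. -/
def IsPolytopeOver (K : Subfield ℝ) {n : ℕ} (P : Set (Fin n → ℝ)) : Prop :=
  ∃ S : Finset (Fin n → ℝ), (∀ x ∈ S, IsPointOver K x) ∧
    P = convexHull ℝ (S : Set (Fin n → ℝ))

/-- `B` is obtained from the polytope `A` by removing an open half-space over `K` that contains
exactly one of the points generating `A`. If `strict` holds, then another generating point is
required to lie in the opposite open half-space. -/
def IsCutOver (K : Subfield ℝ) (strict : Prop) {n : ℕ} (A B : Set (Fin n → ℝ)) : Prop :=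
  ∃ (W : Finset (Fin n → ℝ)) (v : Fin n → ℝ) (f : (Fin n → ℝ) →ₗ[ℝ] ℝ) (c : ℝ),
    (∀ w ∈ W, IsPointOver K w) ∧ IsPointOver K v ∧ IsFunctionalOver K f ∧ c ∈ K ∧
    A = convexHull ℝ (insert v (W : Set (Fin n → ℝ))) ∧ c < f v ∧ (∀ w ∈ W, f w ≤ c) ∧
    (strict → ∃ w ∈ W, f w < c) ∧ B = A ∩ {x | f x ≤ c}

/-- A cut or an enlargement, with result a polytope over `K` contained in `X`. -/
def MoveOver (K : Subfield ℝ) (strict : Prop) {n : ℕ} (X A B : Set (Fin n → ℝ)) : Prop :=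
  IsPolytopeOver K B ∧ B ⊆ X ∧ (IsCutOver K strict A B ∨ A ⊆ B)

/-- The reflexive transitive closure of `MoveOver`. -/
def ReachOver (K : Subfield ℝ) (strict : Prop) {n : ℕ} (X : Set (Fin n → ℝ)) :
    Set (Fin n → ℝ) → Set (Fin n → ℝ) → Prop :=
  Relation.ReflTransGen (MoveOver K strict X)

/-! ### Half-space description of finitely generated cones -/

open scoped NNReal in
/-- Weyl's theorem: a finitely generated cone is a finite intersection of half-spaces, and these
can be taken from any class `Φ` of functionals closed under elimination at the generators. -/
theorem exists_finset_dual_mem_span_iff {E : Type*} [AddCommGroup E] [Module ℝ E]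
    (Φ : Set (E →ₗ[ℝ] ℝ)) (J₀ : Finset (E →ₗ[ℝ] ℝ)) (hJ₀ : ∀ a ∈ J₀, a ∈ Φ)
    (hzero : ∀ y, (∀ a ∈ J₀, a y ≤ 0) ↔ y = 0) (T : Finset E)
    (hΦ : ∀ x ∈ T, ∀ a ∈ Φ, ∀ b ∈ Φ, a x • b - b x • a ∈ Φ) :
    ∃ J : Finset (E →ₗ[ℝ] ℝ), (∀ a ∈ J, a ∈ Φ) ∧
      ∀ y, (∀ a ∈ J, a y ≤ 0) ↔ y ∈ Submodule.span ℝ≥0 (T : Set E) := by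
  classical
  induction T using Finset.induction_on with
  | empty => exact ⟨J₀, hJ₀, fun y => by simpa using hzero y⟩
  | insert x T hx ih =>
    obtain ⟨J, hJ, hJT⟩ := ih fun z hz => hΦ z (Finset.mem_insert_of_mem hz)
    refine ⟨J.filter (fun a => a x ≤ 0) ∪
      ((J.filter fun a => 0 < a x) ×ˢ (J.filter fun a => a x ≤ 0)).image
        (fun q => q.1 x • q.2 - q.2 x • q.1), ?_, fun y => ?_⟩
    · intro a ha
      simp only [Finset.mem_union, Finset.mem_filter, Finset.mem_image, Finset.mem_product] at ha
      rcases ha with ha | ⟨q, ⟨⟨h1, -⟩, h2, -⟩, rfl⟩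
      · exact hJ a ha.1
      · exact hΦ x (Finset.mem_insert_self _ _) _ (hJ _ h1) _ (hJ _ h2)
    · rw [Finset.coe_insert, Submodule.mem_span_insert]
      constructor
      · intro h
        have hneg : ∀ a ∈ J, a x ≤ 0 → a y ≤ 0 := fun a ha hax =>
          h a (Finset.mem_union_left _ (Finset.mem_filter.2 ⟨ha, hax⟩))
        have hpair : ∀ a ∈ J, 0 < a x → ∀ b ∈ J, b x ≤ 0 → a x * b y - b x * a y ≤ 0 := by
          intro a ha hax b hb hbx
          have := h (a x • b - b x • a) (Finset.mem_union_right _ (Finset.mem_image.2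
            ⟨(a, b), by simp [ha, hax, hb, hbx], rfl⟩))
          simpa using this
        obtain ⟨t, ht0, ht⟩ : ∃ t : ℝ, 0 ≤ t ∧ ∀ a ∈ J, a y - t * a x ≤ 0 := by
          let R := insert 0 ((J.filter fun a => 0 < a x).image fun a => a y / a x)
          have hR : R.Nonempty := ⟨0, Finset.mem_insert_self _ _⟩
          refine ⟨R.max' hR, R.le_max' _ (Finset.mem_insert_self _ _), fun a ha => ?_⟩
          rcases lt_or_ge 0 (a x) with hax | hax
          · have : a y / a x ≤ R.max' hR := R.le_max' _ (Finset.mem_insert_of_mem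
              (Finset.mem_image.2 ⟨a, Finset.mem_filter.2 ⟨ha, hax⟩, rfl⟩))
            rw [div_le_iff₀ hax] at this
            linarith
          · have hmem := R.max'_mem hR
            rcases Finset.mem_insert.1 hmem with h0 | h1
            · rw [h0]
              simpa using hneg a ha hax
            · obtain ⟨b, hb, hbe⟩ := Finset.mem_image.1 h1
              rw [Finset.mem_filter] at hb
              rw [← hbe]
              have := hpair b hb.1 hb.2 a ha hax
              have hb0 := hb.2
              have e : a y - b y / b x * a x = (b x * a y - a x * b y) / b x := by
                field_simp
              rw [e]
              exact div_nonpos_of_nonpos_of_nonneg this hb0.le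
        refine ⟨⟨t, ht0⟩, y - t • x, (hJT _).1 fun a ha => ?_, ?_⟩
        · simpa using ht a ha
        · change y = t • x + (y - t • x)
          abel
      · rintro ⟨t, z, hz, rfl⟩ a ha
        have hz' := (hJT z).2 hz
        have hsm : ∀ b : E →ₗ[ℝ] ℝ, b (t • x + z) = t * b x + b z := fun b => by
          rw [map_add]
          congr 1
          exact b.map_smul (t : ℝ) x
        have ht0 : (0 : ℝ) ≤ t := t.2
        simp only [Finset.mem_union, Finset.mem_filter, Finset.mem_image, Finset.mem_product] at ha
        rcases ha with ha | ⟨q, ⟨⟨h1, h1x⟩, h2, h2x⟩, rfl⟩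
        · rw [hsm]
          nlinarith [hz' a ha.1, mul_nonneg ht0 (neg_nonneg.2 ha.2)]
        · simp only [LinearMap.sub_apply, LinearMap.smul_apply, smul_eq_mul, hsm]
          nlinarith [mul_nonneg h1x.le (neg_nonneg.2 (hz' _ h2)),
            mul_nonneg (neg_nonneg.2 h2x) (neg_nonneg.2 (hz' _ h1))]

open scoped NNReal in
/-- A half-space description over `K` of a cone generated by vectors over `K`. -/
theorem exists_finset_functionalOver_mem_span_iff (K : Subfield ℝ) {n : ℕ}
    (T : Finset ((Fin n → ℝ) × ℝ)) (hT : ∀ x ∈ T, IsPointOver K x.1 ∧ x.2 ∈ K) :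
    ∃ J : Finset (((Fin n → ℝ) →ₗ[ℝ] ℝ) × ℝ), (∀ j ∈ J, IsFunctionalOver K j.1 ∧ j.2 ∈ K) ∧
      ∀ y r, (∀ j ∈ J, j.1 y ≤ r * j.2) ↔ (y, r) ∈ Submodule.span ℝ≥0 (T : Set _) := by
  classical
  let Φ : Set (((Fin n → ℝ) × ℝ) →ₗ[ℝ] ℝ) :=
    {a | ∀ x r, IsPointOver K x → r ∈ K → a (x, r) ∈ K}
  let coord : Fin n → ((Fin n → ℝ) × ℝ) →ₗ[ℝ] ℝ :=
    fun i => LinearMap.proj i ∘ₗ LinearMap.fst ℝ (Fin n → ℝ) ℝ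
  let last : ((Fin n → ℝ) × ℝ) →ₗ[ℝ] ℝ := LinearMap.snd ℝ (Fin n → ℝ) ℝ
  let J₀ : Finset (((Fin n → ℝ) × ℝ) →ₗ[ℝ] ℝ) :=
    (Finset.univ.image coord ∪ Finset.univ.image fun i => -coord i) ∪ {last, -last}
  obtain ⟨J, hJ, hJT⟩ := exists_finset_dual_mem_span_iff Φ J₀ (by
      intro a ha x r hx hr
      simp only [J₀, Finset.mem_union, Finset.mem_image, Finset.mem_univ, true_and,
        Finset.mem_insert, Finset.mem_singleton] at ha
      rcases ha with (⟨i, rfl⟩ | ⟨i, rfl⟩) | rfl | rfl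
      · exact hx i
      · exact K.neg_mem (hx i)
      · exact hr
      · exact K.neg_mem hr) (by
      intro y
      constructor
      · intro h
        have h1 : ∀ i, y.1 i = 0 := fun i => le_antisymm
          (h (coord i) (by simp [J₀])) (by
            have := h (-coord i) (by simp [J₀])
            simpa [coord] using this)
        have h2 : y.2 = 0 := le_antisymm (h last (by simp [J₀])) (by
            have := h (-last) (by simp [J₀])
            simpa [last] using this)
        exact Prod.ext (funext h1) h2
      · rintro rfl a -
        simp) T (by
      intro x hx a ha b hb y r hy hr
      have hx' := hT x hx
      exact K.sub_mem (K.mul_mem (ha _ _ hx'.1 hx'.2) (hb _ _ hy hr))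
        (K.mul_mem (hb _ _ hx'.1 hx'.2) (ha _ _ hy hr)))
  refine ⟨J.image fun a => (a ∘ₗ LinearMap.inl ℝ (Fin n → ℝ) ℝ, -a (0, 1)), ?_, fun y r => ?_⟩
  · intro j hj
    obtain ⟨a, ha, rfl⟩ := Finset.mem_image.1 hj
    exact ⟨fun x hx => hJ a ha x 0 hx K.zero_mem,
      K.neg_mem (hJ a ha 0 1 (fun i => K.zero_mem) K.one_mem)⟩
  · have key : ∀ a : ((Fin n → ℝ) × ℝ) →ₗ[ℝ] ℝ, a (y, r) = a (y, 0) + r * a (0, 1) := fun a => by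
      rw [← smul_eq_mul, ← map_smul, ← map_add]
      simp
    rw [← hJT]
    simp only [Finset.forall_mem_image]
    refine forall₂_congr fun a _ => ?_
    rw [key]
    simp only [LinearMap.comp_apply, LinearMap.inl_apply]
    constructor <;> intro h <;> linarith

open scoped NNReal in
theorem mem_convexHull_of_mem_span_nnreal {E : Type*} [AddCommGroup E] [Module ℝ E] {S : Set E}
    {y : E} (h : (y, (1 : ℝ)) ∈ Submodule.span ℝ≥0 ((fun x => (x, (1 : ℝ))) '' S)) :
    y ∈ convexHull ℝ S := by
  have key : ∀ z ∈ Submodule.span ℝ≥0 ((fun x : E => (x, (1 : ℝ))) '' S),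
      z = 0 ∨ 0 < z.2 ∧ ∃ x ∈ convexHull ℝ S, z.1 = z.2 • x := by
    intro z hz
    induction hz using Submodule.span_induction with
    | mem z hz =>
      obtain ⟨x, hx, rfl⟩ := hz
      exact Or.inr ⟨one_pos, x, subset_convexHull ℝ S hx, by simp⟩
    | zero => exact Or.inl rfl
    | add z w _ _ hz hw =>
      rcases hz with rfl | ⟨hz, x, hx, hzx⟩
      · simpa using hw
      rcases hw with rfl | ⟨hw, x', hx', hwx⟩
      · simpa using Or.inr ⟨hz, x, hx, hzx⟩
      have hpos : 0 < z.2 + w.2 := add_pos hz hw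
      refine Or.inr ⟨hpos, (z.2 / (z.2 + w.2)) • x + (w.2 / (z.2 + w.2)) • x',
        convex_convexHull ℝ S hx hx' (by positivity) (by positivity) (by field_simp), ?_⟩
      rw [Prod.fst_add, Prod.snd_add, smul_add, smul_smul, smul_smul, hzx, hwx,
        mul_div_cancel₀ _ hpos.ne', mul_div_cancel₀ _ hpos.ne']
    | smul a z _ hz =>
      rcases hz with rfl | ⟨hz, x, hx, hzx⟩
      · simp
      rcases eq_or_ne a 0 with rfl | ha
      · simp
      have ha' : (0 : ℝ) < a := by exact_mod_cast pos_iff_ne_zero.2 ha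
      refine Or.inr ⟨mul_pos ha' hz, x, hx, ?_⟩
      change (a : ℝ) • z.1 = ((a : ℝ) * z.2) • x
      rw [hzx, smul_smul]
  rcases key _ h with h0 | ⟨-, x, hx, hyx⟩
  · simp at h0
  · obtain rfl : y = x := by simpa using hyx
    exact hx

/-- The Weyl half of the Minkowski–Weyl theorem, over `K`. -/
theorem IsPolytopeOver.exists_halfspaces {K : Subfield ℝ} {n : ℕ} {P : Set (Fin n → ℝ)}
    (hP : IsPolytopeOver K P) :
    ∃ J : Finset (((Fin n → ℝ) →ₗ[ℝ] ℝ) × ℝ), (∀ j ∈ J, IsFunctionalOver K j.1 ∧ j.2 ∈ K) ∧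
      ∀ y, y ∈ P ↔ ∀ j ∈ J, j.1 y ≤ j.2 := by
  classical
  obtain ⟨S, hS, rfl⟩ := hP
  obtain ⟨J, hJ, hJS⟩ := exists_finset_functionalOver_mem_span_iff K
    (S.image fun x => (x, (1 : ℝ))) (by
      simpa [Finset.forall_mem_image] using hS)
  refine ⟨J, hJ, fun y => ⟨fun hy j hj => ?_, fun hy => ?_⟩⟩
  · refine convexHull_min (t := {y | j.1 y ≤ j.2}) (fun x hx => ?_)
      (convex_halfSpace_le j.1.isLinear _) hy
    have := (hJS x 1).2 (Submodule.subset_span (by simpa using hx)) j hj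
    simpa using this
  · have := (hJS y 1).1 (by simpa using hy)
    rw [Finset.coe_image] at this
    exact mem_convexHull_of_mem_span_nnreal this

open scoped NNReal in
/-- A point over `K` outside the affine span of points over `K` is separated from it by an affine
functional over `K`. -/
theorem exists_functionalOver_of_notMem_affineSpan {K : Subfield ℝ} {n : ℕ}
    {S : Finset (Fin n → ℝ)} (hS : ∀ x ∈ S, IsPointOver K x) {s : Fin n → ℝ}
    (hs : s ∉ affineSpan ℝ (S : Set (Fin n → ℝ))) :
    ∃ (f : (Fin n → ℝ) →ₗ[ℝ] ℝ) (c : ℝ), IsFunctionalOver K f ∧ c ∈ K ∧ c < f s ∧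
      ∀ x ∈ S, f x = c := by
  classical
  rcases S.eq_empty_or_nonempty with rfl | ⟨x₀, hx₀⟩
  · exact ⟨0, -1, fun _ _ => K.zero_mem, K.neg_mem K.one_mem, by simp, by simp⟩
  obtain ⟨J, hJ, hJS⟩ := exists_finset_functionalOver_mem_span_iff K
    ((S.image fun x => (x, (1 : ℝ))) ∪ S.image fun x => (-x, (-1 : ℝ))) (by
      intro x hx
      rcases Finset.mem_union.1 hx with hx | hx <;> obtain ⟨y, hy, rfl⟩ := Finset.mem_image.1 hx
      · exact ⟨hS y hy, K.one_mem⟩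
      · exact ⟨fun i => K.neg_mem (hS y hy i), K.neg_mem K.one_mem⟩)
  have hns : (s, (1 : ℝ)) ∉ Submodule.span ℝ≥0 ((((S.image fun x => (x, (1 : ℝ))) ∪
      S.image fun x => (-x, (-1 : ℝ)) : Finset _)) : Set ((Fin n → ℝ) × ℝ)) := by
    intro h
    have key : ∀ z ∈ Submodule.span ℝ≥0 ((((S.image fun x => (x, (1 : ℝ))) ∪
        S.image fun x => (-x, (-1 : ℝ)) : Finset _)) : Set ((Fin n → ℝ) × ℝ)),
        z.1 - z.2 • x₀ ∈ vectorSpan ℝ (S : Set (Fin n → ℝ)) := by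
      intro z hz
      induction hz using Submodule.span_induction with
      | mem z hz =>
        rcases Finset.mem_union.1 hz with hz | hz <;> obtain ⟨x, hx, rfl⟩ := Finset.mem_image.1 hz
        · simpa using vsub_mem_vectorSpan ℝ (Finset.mem_coe.2 hx) (Finset.mem_coe.2 hx₀)
        · have := vsub_mem_vectorSpan ℝ (Finset.mem_coe.2 hx₀) (Finset.mem_coe.2 hx)
          rw [vsub_eq_sub] at this
          convert this using 1
          simp only [neg_smul, one_smul]
          abel
      | zero => simp
      | add z w _ _ hz hw =>
        convert Submodule.add_mem _ hz hw using 1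
        simp only [Prod.fst_add, Prod.snd_add, add_smul]
        abel
      | smul a z _ hz =>
        convert Submodule.smul_mem _ (a : ℝ) hz using 1
        rw [smul_sub, smul_smul]
        rfl
    have h1 := key _ h
    apply hs
    have h2 := AffineSubspace.vadd_mem_of_mem_direction
      (by rwa [direction_affineSpan]) (mem_affineSpan ℝ (Finset.mem_coe.2 hx₀))
    simpa using h2
  rw [← hJS] at hns
  push Not at hns
  obtain ⟨j, hj, hjs⟩ := hns
  refine ⟨j.1, j.2, (hJ j hj).1, (hJ j hj).2, by simpa using hjs, fun x hx => le_antisymm ?_ ?_⟩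
  · have := (hJS x 1).2 (Submodule.subset_span (Finset.mem_union_left _
      (Finset.mem_image_of_mem _ hx))) j hj
    simpa using this
  · have := (hJS (-x) (-1)).2 (Submodule.subset_span (Finset.mem_union_right _
      (Finset.mem_image_of_mem (fun x => (-x, (-1 : ℝ))) hx))) j hj
    simpa using this

/-! ### Geometry of cuts -/

/-- The intersection of the line through `v` and `w` with the hyperplane `f = c`. -/
noncomputable def crossing {E : Type*} [AddCommGroup E] [Module ℝ E] (f : E →ₗ[ℝ] ℝ) (c : ℝ)
    (v w : E) : E :=
  v + ((f v - c) / (f v - f w)) • (w - v)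

section Crossing

variable {E : Type*} [AddCommGroup E] [Module ℝ E] {f : E →ₗ[ℝ] ℝ} {c : ℝ} {v : E} {W : Set E}

theorem apply_crossing {w : E} (hv : c < f v) (hw : f w ≤ c) : f (crossing f c v w) = c := by
  have : f v - f w ≠ 0 := by linarith
  simp only [crossing, map_add, map_smul, map_sub, smul_eq_mul]
  field_simp
  ring

theorem apply_of_mem_convexHull_crossing (hv : c < f v) (hW : ∀ w ∈ W, f w ≤ c) {y : E}
    (hy : y ∈ convexHull ℝ (crossing f c v '' W)) : f y = c := by
  refine convexHull_min (t := {y | f y = c}) ?_ (convex_hyperplane f.isLinear _) hy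
  rintro _ ⟨w, hw, rfl⟩
  exact apply_crossing hv (hW w hw)

theorem crossing_mem_convexHull (hv : c < f v) (hW : ∀ w ∈ W, f w ≤ c) {w : E} (hw : w ∈ W) :
    crossing f c v w ∈ convexHull ℝ (insert v W) := by
  have h : 0 < f v - f w := by linarith [hW w hw]
  refine (convex_convexHull ℝ _).add_smul_sub_mem (subset_convexHull ℝ _ (mem_insert _ _))
    (subset_convexHull ℝ _ (mem_insert_of_mem _ hw)) ⟨div_nonneg (by linarith) h.le, ?_⟩
  rw [div_le_one h]
  linarith [hW w hw]

/-- Central projection from `v` to the hyperplane `f = c`. -/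
theorem exists_mem_convexHull_crossing (hv : c < f v) (hW : ∀ w ∈ W, f w ≤ c) {x : E}
    (hx : x ∈ convexHull ℝ (insert v W)) :
    x = v ∨ ∃ s : ℝ, 0 < s ∧ ∃ y ∈ convexHull ℝ (crossing f c v '' W), x = v + s • (y - v) := by
  refine convexHull_min (t := {x | x = v ∨ ∃ s : ℝ, 0 < s ∧
    ∃ y ∈ convexHull ℝ (crossing f c v '' W), x = v + s • (y - v)}) ?_ ?_ hx
  · rintro w (rfl | hw)
    · exact Or.inl rfl
    · have h1 : 0 < f v - c := by linarith
      have h2 : 0 < f v - f w := by linarith [hW w hw]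
      refine Or.inr ⟨(f v - f w) / (f v - c), by positivity, crossing f c v w,
        subset_convexHull ℝ _ (mem_image_of_mem _ hw), ?_⟩
      rw [crossing, add_sub_cancel_left, smul_smul, div_mul_div_cancel₀ h1.ne', div_self h2.ne',
        one_smul, add_sub_cancel]
  · have key : ∀ x ∈ {x | x = v ∨ ∃ s : ℝ, 0 < s ∧
        ∃ y ∈ convexHull ℝ (crossing f c v '' W), x = v + s • (y - v)}, ∀ a : ℝ, 0 < a →
        v + a • (x - v) ∈ {x | x = v ∨ ∃ s : ℝ, 0 < s ∧
        ∃ y ∈ convexHull ℝ (crossing f c v '' W), x = v + s • (y - v)} := by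
      rintro x (rfl | ⟨s, hs, y, hy, rfl⟩) a ha
      · simp
      · exact Or.inr ⟨a * s, by positivity, y, hy, by rw [add_sub_cancel_left, smul_smul]⟩
    refine convex_iff_forall_pos.2 fun x hx x' hx' a b ha hb hab => ?_
    have e : ∀ z z' : E, a • z + b • z' = v + (a • (z - v) + b • (z' - v)) := fun z z' => by
      have : v = a • v + b • v := by rw [← add_smul, hab, one_smul]
      nth_rewrite 1 [this]
      simp only [smul_sub]
      abel
    rw [e]
    rcases hx with rfl | ⟨s, hs, y, hy, rfl⟩
    · simpa using key x' hx' b hb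
    rcases hx' with rfl | ⟨s', hs', y', hy', rfl⟩
    · simpa using key _ (Or.inr ⟨s, hs, y, hy, rfl⟩) a ha
    have hpos : 0 < a * s + b * s' := by positivity
    refine Or.inr ⟨a * s + b * s', hpos,
      (a * s / (a * s + b * s')) • y + (b * s' / (a * s + b * s')) • y',
      convex_convexHull ℝ _ hy hy' (by positivity) (by positivity) (by field_simp), ?_⟩
    have e2 : (a * s + b * s') • v = (a * s) • v + (b * s') • v := add_smul _ _ _
    simp only [add_sub_cancel_left, smul_sub, smul_add, smul_smul, e2]
    rw [mul_div_cancel₀ _ hpos.ne', mul_div_cancel₀ _ hpos.ne']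
    abel

theorem apply_add_smul_sub {y : E} (hy : f y = c) (s : ℝ) :
    f (v + s • (y - v)) = f v - s * (f v - c) := by
  simp only [map_add, map_smul, map_sub, smul_eq_mul, hy]
  ring

theorem apply_le_of_mem_convexHull_insert (hv : c < f v) (hW : ∀ w ∈ W, f w ≤ c) {x : E}
    (hx : x ∈ convexHull ℝ (insert v W)) : f x ≤ f v ∧ (f x = f v → x = v) := by
  rcases exists_mem_convexHull_crossing hv hW hx with rfl | ⟨s, hs, y, hy, rfl⟩
  · simp
  · rw [apply_add_smul_sub (apply_of_mem_convexHull_crossing hv hW hy)]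
    have : 0 < s * (f v - c) := mul_pos hs (by linarith)
    exact ⟨by linarith, fun h => by linarith⟩

/-- The pyramid removed by a cut. -/
theorem convexHull_insert_inter_halfSpace_ge (hv : c < f v) (hW : ∀ w ∈ W, f w ≤ c) :
    convexHull ℝ (insert v W) ∩ {x | c ≤ f x} =
      convexHull ℝ (insert v (crossing f c v '' W)) := by
  apply Subset.antisymm
  · rintro x ⟨hx, hxc⟩
    rcases exists_mem_convexHull_crossing hv hW hx with rfl | ⟨s, hs, y, hy, rfl⟩
    · exact subset_convexHull ℝ _ (mem_insert _ _)
    · rw [mem_ofPred_eq, apply_add_smul_sub (apply_of_mem_convexHull_crossing hv hW hy)] at hxc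
      refine (convex_convexHull ℝ _).add_smul_sub_mem (subset_convexHull ℝ _ (mem_insert _ _))
        (convexHull_mono (subset_insert _ _) hy) ⟨hs.le, ?_⟩
      nlinarith
  · refine convexHull_min ?_ ((convex_convexHull ℝ _).inter (convex_halfSpace_ge f.isLinear _))
    rintro _ (rfl | ⟨w, hw, rfl⟩)
    · exact ⟨subset_convexHull ℝ _ (mem_insert _ _), hv.le⟩
    · exact ⟨crossing_mem_convexHull hv hW hw, (apply_crossing hv (hW w hw)).ge⟩

/-- The polytope remaining after a cut. -/
theorem convexHull_insert_inter_halfSpace_le (hv : c < f v) (hW : ∀ w ∈ W, f w ≤ c) :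
    convexHull ℝ (insert v W) ∩ {x | f x ≤ c} =
      convexHull ℝ (W ∪ crossing f c v '' W) := by
  apply Subset.antisymm
  · rintro x ⟨hx, hxc⟩
    rcases W.eq_empty_or_nonempty with rfl | hne
    · simp only [insert_empty_eq, convexHull_singleton, mem_singleton_iff] at hx
      subst hx
      exact absurd hxc (not_le.2 hv)
    rw [convexHull_insert hne, mem_convexJoin] at hx
    obtain ⟨u, hu, y, hy, a, b, ha, hb, hab, hx⟩ := hx
    rw [mem_singleton_iff.1 hu] at hx
    subst hx
    have hyc : f y ≤ c := convexHull_min (t := {y | f y ≤ c}) hW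
      (convex_halfSpace_le f.isLinear _) hy
    rcases exists_mem_convexHull_crossing hv hW (convexHull_mono (subset_insert _ _) hy) with
      rfl | ⟨s, hs, z, hz, rfl⟩
    · exact absurd hyc (not_le.2 hv)
    have hfz := apply_of_mem_convexHull_crossing hv hW hz
    obtain rfl : a = 1 - b := by linarith
    have e : ∀ u : ℝ, (1 - b) • v + b • (v + u • (z - v)) = v + (b * u) • (z - v) := fun u => by
      simp only [sub_smul, one_smul, smul_add, smul_smul]
      abel
    rw [e] at hxc ⊢
    rw [mem_ofPred_eq, apply_add_smul_sub hfz] at hxc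
    have hbs : 1 ≤ b * s := by
      by_contra h
      nlinarith [mul_pos (sub_pos.2 (not_le.1 h)) (sub_pos.2 hv)]
    have hs1 : 1 ≤ s := by nlinarith
    have hz' := convexHull_mono (subset_union_right (s := W)) hz
    have hy' := convexHull_mono (subset_union_left (t := crossing f c v '' W)) hy
    rcases hs1.eq_or_lt with rfl | hs1
    · obtain rfl : b = 1 := by linarith
      simpa using hz'
    · have := (convex_convexHull ℝ _).add_smul_sub_mem hz' hy'
        (t := (b * s - 1) / (s - 1)) ⟨div_nonneg (by linarith) (by linarith), by
          rw [div_le_one (by linarith)]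
          nlinarith⟩
      convert this using 1
      have e1 : v + s • (z - v) - z = (s - 1) • (z - v) := by
        rw [sub_smul, one_smul]
        abel
      rw [e1, smul_smul, div_mul_cancel₀ _ (by linarith), sub_smul, one_smul]
      abel
  · refine convexHull_min ?_ ((convex_convexHull ℝ _).inter (convex_halfSpace_le f.isLinear _))
    rintro _ (hw | ⟨w, hw, rfl⟩)
    · exact ⟨subset_convexHull ℝ _ (mem_insert_of_mem _ hw), hW _ hw⟩
    · exact ⟨crossing_mem_convexHull hv hW hw, (apply_crossing hv (hW w hw)).le⟩

end Crossing

/-- A half-space meeting a convex set in its interior leaves the affine span unchanged. -/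
theorem affineSpan_inter_halfSpace_le {E : Type*} [AddCommGroup E] [Module ℝ E] {A : Set E}
    (hA : Convex ℝ A) {f : E →ₗ[ℝ] ℝ} {c : ℝ} {w : E} (hw : w ∈ A) (hwc : f w < c) :
    affineSpan ℝ (A ∩ {x | f x ≤ c}) = affineSpan ℝ A := by
  apply le_antisymm (affineSpan_mono ℝ inter_subset_left)
  rw [affineSpan_le]
  intro x hx
  have hwB : w ∈ affineSpan ℝ (A ∩ {x | f x ≤ c}) := mem_affineSpan ℝ ⟨hw, hwc.le⟩
  obtain ⟨t, ht0, ht1, ht⟩ : ∃ t : ℝ, 0 < t ∧ t ≤ 1 ∧ t * (f x - f w) ≤ c - f w := by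
    rcases le_or_gt (f x) c with h | h
    · exact ⟨1, one_pos, le_rfl, by linarith⟩
    · have h1 : 0 < f x - f w := by linarith
      refine ⟨(c - f w) / (f x - f w), div_pos (by linarith) h1, ?_, ?_⟩
      · rw [div_le_one h1]
        linarith
      · rw [div_mul_cancel₀ _ h1.ne']
  have hy : w + t • (x - w) ∈ affineSpan ℝ (A ∩ {x | f x ≤ c}) := by
    refine mem_affineSpan ℝ ⟨hA.add_smul_sub_mem hw hx ⟨ht0.le, ht1⟩, ?_⟩
    simp only [mem_ofPred_eq, map_add, map_smul, map_sub, smul_eq_mul]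
    linarith
  have := AffineMap.lineMap_mem t⁻¹ hwB hy
  rw [AffineMap.lineMap_apply_module'] at this
  rw [add_sub_cancel_left, smul_smul, inv_mul_cancel₀ ht0.ne', one_smul, sub_add_cancel] at this
  exact this

/-! ### Cuts over a subfield -/

section Over

variable {K : Subfield ℝ} {n : ℕ}

theorem IsPointOver.add {x y : Fin n → ℝ} (hx : IsPointOver K x) (hy : IsPointOver K y) :
    IsPointOver K (x + y) :=
  fun i => K.add_mem (hx i) (hy i)

theorem IsPointOver.sub {x y : Fin n → ℝ} (hx : IsPointOver K x) (hy : IsPointOver K y) :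
    IsPointOver K (x - y) :=
  fun i => K.sub_mem (hx i) (hy i)

theorem IsPointOver.smul {x : Fin n → ℝ} (hx : IsPointOver K x) {a : ℝ} (ha : a ∈ K) :
    IsPointOver K (a • x) :=
  fun i => K.mul_mem ha (hx i)

theorem IsPointOver.crossing {f : (Fin n → ℝ) →ₗ[ℝ] ℝ} (hf : IsFunctionalOver K f) {c : ℝ}
    (hc : c ∈ K) {v w : Fin n → ℝ} (hv : IsPointOver K v) (hw : IsPointOver K w) :
    IsPointOver K (crossing f c v w) :=
  hv.add ((hw.sub hv).smul
    (K.div_mem (K.sub_mem (hf v hv) hc) (K.sub_mem (hf v hv) (hf w hw))))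

theorem isPolytopeOver_of_finite {S : Set (Fin n → ℝ)} (hS : S.Finite)
    (hK : ∀ x ∈ S, IsPointOver K x) : IsPolytopeOver K (convexHull ℝ S) :=
  ⟨hS.toFinset, by simpa using hK, by simp⟩

theorem IsPolytopeOver.isPolytope {P : Set (Fin n → ℝ)} (hP : IsPolytopeOver K P) :
    IsPolytope P := by
  obtain ⟨S, -, hS⟩ := hP
  exact ⟨S, hS⟩

theorem IsPolytopeOver.convex {P : Set (Fin n → ℝ)} (hP : IsPolytopeOver K P) : Convex ℝ P := by
  obtain ⟨S, -, rfl⟩ := hP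
  exact convex_convexHull ℝ _

theorem IsPolytopeOver.isVertex {P : Set (Fin n → ℝ)} (hP : IsPolytopeOver K P) {v : Fin n → ℝ}
    (hv : IsVertex P v) : IsPointOver K v := by
  classical
  obtain ⟨S, hS, rfl⟩ := hP
  obtain ⟨f, c, -, hle, hF⟩ := hv
  have hvF : v ∈ {x ∈ convexHull ℝ (S : Set (Fin n → ℝ)) | f x = c} := hF ▸ mem_singleton v
  apply hS
  by_contra hvS
  have hlt : ∀ x ∈ S, f x < c := fun x hx => by
    refine lt_of_le_of_ne (hle x (subset_convexHull ℝ _ hx)) fun h => hvS ?_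
    have : x ∈ ({v} : Set (Fin n → ℝ)) := hF ▸ ⟨subset_convexHull ℝ _ hx, h⟩
    rwa [← mem_singleton_iff.1 this]
  have := convexHull_min (t := {x | f x < c}) hlt (convex_halfSpace_lt f.isLinear _) hvF.1
  exact (lt_irrefl c) (hvF.2 ▸ this)

theorem IsPolytopeOver.isRationalPolytope {P : Set (Fin n → ℝ)}
    (hP : IsPolytopeOver (algebraMap ℚ ℝ).fieldRange P) : IsRationalPolytope P :=
  ⟨hP.isPolytope, fun v hv i => by
    obtain ⟨q, hq⟩ := hP.isVertex hv i
    exact ⟨q, hq.symm⟩⟩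

/-- A polytope is the convex hull of its vertices. -/
theorem IsPolytope.exists_finset_isVertex {P : Set (Fin n → ℝ)} (hP : IsPolytope P)
    (hn : n ≠ 0) :
    ∃ S : Finset (Fin n → ℝ), (∀ v ∈ S, IsVertex P v) ∧
      P = convexHull ℝ (S : Set (Fin n → ℝ)) := by
  classical
  obtain ⟨S, hS⟩ := hP
  induction S using Finset.strongInduction with
  | H S ih =>
    by_cases h : ∃ v ∈ S, v ∈ convexHull ℝ ((S.erase v : Finset _) : Set (Fin n → ℝ))
    · obtain ⟨v, hv, hvS⟩ := h
      refine ih _ (Finset.erase_ssubset hv) (hS.trans (Subset.antisymm ?_ ?_))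
      · refine convexHull_min (fun x hx => ?_) (convex_convexHull ℝ _)
        rcases eq_or_ne x v with rfl | hxv
        · exact hvS
        · exact subset_convexHull ℝ _ (Finset.mem_erase.2 ⟨hxv, hx⟩)
      · exact convexHull_mono (Finset.coe_subset.2 (Finset.erase_subset _ _))
    · push Not at h
      refine ⟨S, fun v hv => ?_, hS⟩
      obtain ⟨f, u, hfu, hfv⟩ := geometric_hahn_banach_closed_point (convex_convexHull ℝ _)
        ((S.erase v).finite_toSet.isClosed_convexHull ℝ) (h v hv)
      have hPe : P = convexHull ℝ (insert v ((S.erase v : Finset _) : Set (Fin n → ℝ))) := by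
        rw [← Finset.coe_insert, Finset.insert_erase hv, hS]
      have hmax : ∀ x ∈ P, f x ≤ f v ∧ (f x = f v → x = v) := fun x hx =>
        apply_le_of_mem_convexHull_insert (f := f.toLinearMap) hfv
          (fun w hw => (hfu w (subset_convexHull ℝ _ hw)).le) (hPe ▸ hx)
      have hvP : v ∈ P := hS ▸ subset_convexHull ℝ _ hv
      by_cases hf : f = 0
      · have hPv : P = {v} := Subset.antisymm
          (fun x hx => (hmax x hx).2 (by simp [hf])) (by simpa using hvP)
        obtain ⟨m, rfl⟩ := Nat.exists_eq_succ_of_ne_zero hn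
        refine ⟨LinearMap.proj 0, v 0, fun h0 => ?_, by simp [hPv], ?_⟩
        · have := LinearMap.congr_fun h0 (fun _ => 1)
          simp at this
        · ext x
          simp only [hPv, mem_singleton_iff, mem_ofPred_eq, LinearMap.proj_apply]
          exact ⟨fun h => ⟨h, by rw [h]⟩, fun h => h.1⟩
      · refine ⟨f.toLinearMap, f v, fun h0 => hf ?_, fun x hx => (hmax x hx).1, ?_⟩
        · ext x
          exact LinearMap.congr_fun h0 x
        · ext x
          simp only [mem_singleton_iff, mem_ofPred_eq]
          exact ⟨fun h => by subst h; exact ⟨hvP, rfl⟩, fun h => (hmax x h.1).2 h.2⟩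

theorem IsRationalPolytope.isPolytopeOver {P : Set (Fin n → ℝ)} (hP : IsRationalPolytope P) :
    IsPolytopeOver (algebraMap ℚ ℝ).fieldRange P := by
  rcases eq_or_ne n 0 with rfl | hn
  · obtain ⟨S, hS⟩ := hP.1
    exact ⟨S, fun x _ i => i.elim0, hS⟩
  · obtain ⟨S, hS, hPS⟩ := hP.1.exists_finset_isVertex hn
    refine ⟨S, fun v hv i => ?_, hPS⟩
    obtain ⟨q, hq⟩ := hP.2 v (hS v hv) i
    exact ⟨q, hq.symm⟩

theorem IsPolytope.isPolytopeOver_top {P : Set (Fin n → ℝ)} (hP : IsPolytope P) :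
    IsPolytopeOver ⊤ P := by
  obtain ⟨S, hS⟩ := hP
  exact ⟨S, fun _ _ _ => Subfield.mem_top _, hS⟩

variable {strict : Prop} {A B : Set (Fin n → ℝ)}

theorem IsCutOver.isPolytopeOver_right (h : IsCutOver K strict A B) : IsPolytopeOver K B := by
  obtain ⟨W, v, f, c, hW, hv, hf, hc, rfl, hfv, hfW, -, rfl⟩ := h
  rw [convexHull_insert_inter_halfSpace_le hfv hfW]
  refine isPolytopeOver_of_finite (W.finite_toSet.union (W.finite_toSet.image _)) ?_
  rintro _ (hw | ⟨w, hw, rfl⟩)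
  · exact hW _ hw
  · exact hv.crossing hf hc (hW w hw)

theorem IsCutOver.subset (h : IsCutOver K strict A B) : B ⊆ A := by
  obtain ⟨W, v, f, c, hW, hv, hf, hc, rfl, hfv, hfW, -, rfl⟩ := h
  exact inter_subset_left

theorem IsCutOver.affineSpan_eq (h : IsCutOver K True A B) :
    affineSpan ℝ B = affineSpan ℝ A := by
  obtain ⟨W, v, f, c, hW, hv, hf, hc, rfl, hfv, hfW, hstrict, rfl⟩ := h
  obtain ⟨w, hw, hwc⟩ := hstrict trivial
  exact affineSpan_inter_halfSpace_le (convex_convexHull ℝ _)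
    (subset_convexHull ℝ _ (mem_insert_of_mem _ hw)) hwc

theorem polyDim_convexHull_insert {v : Fin n → ℝ} {F : Set (Fin n → ℝ)} (hF : F.Nonempty)
    (hv : v ∉ affineSpan ℝ F) : polyDim F = polyDim (convexHull ℝ (insert v F)) - 1 := by
  obtain ⟨y, hy⟩ := hF
  have hy' := mem_affineSpan ℝ hy
  have hnot : v - y ∉ (affineSpan ℝ F).direction := fun h => hv <| by
    simpa using AffineSubspace.vadd_mem_of_mem_direction h hy'
  have hdir : (affineSpan ℝ (insert v F)).direction =
      (affineSpan ℝ F).direction ⊔ Submodule.span ℝ {v - y} := by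
    rw [← affineSpan_insert_affineSpan, sup_comm,
      AffineSubspace.direction_affineSpan_insert hy', vsub_eq_sub]
  have hfin : Module.finrank ℝ (affineSpan ℝ (insert v F)).direction =
      Module.finrank ℝ (affineSpan ℝ F).direction + 1 := by
    rw [hdir]
    have h1 := Submodule.finrank_add_le_finrank_add_finrank (affineSpan ℝ F).direction
      (Submodule.span ℝ {v - y})
    have h2 := finrank_span_singleton (K := ℝ) (v := v - y)
      (fun h => hnot (h ▸ Submodule.zero_mem _))
    have h3 : (affineSpan ℝ F).direction <
        (affineSpan ℝ F).direction ⊔ Submodule.span ℝ {v - y} :=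
      lt_of_le_of_ne le_sup_left fun h => hnot <| h ▸ Submodule.mem_sup_right
        (Submodule.mem_span_singleton_self _)
    have h4 := Submodule.finrank_lt_finrank_of_lt h3
    omega
  rw [polyDim, polyDim, affineSpan_convexHull, hfin, Nat.add_sub_cancel]

/-- A strict cut is the inverse of a pyramidal extension. -/
theorem IsCutOver.isPyramidalExtension (h : IsCutOver K True A B) :
    IsPyramidalExtension B A := by
  have hB := h.isPolytopeOver_right.isPolytope
  have hspan := h.affineSpan_eq
  obtain ⟨W, v, f, c, hW, hv, hf, hc, rfl, hfv, hfW, hstrict, rfl⟩ := h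
  obtain ⟨w, hw, hwc⟩ := hstrict trivial
  set A := convexHull ℝ (insert v (W : Set (Fin n → ℝ))) with hA
  have hf0 : f ≠ 0 := by
    rintro rfl
    simp only [LinearMap.zero_apply] at hfv hwc
    linarith
  have hvA : v ∈ A := subset_convexHull ℝ _ (mem_insert _ _)
  have hmax : ∀ x ∈ A, f x ≤ f v ∧ (f x = f v → x = v) := fun x hx =>
    apply_le_of_mem_convexHull_insert hfv hfW hx
  have hvert : ∀ C ⊆ A, v ∈ C → IsVertex C v := by
    intro C hC hvC
    refine ⟨f, f v, hf0, fun x hx => (hmax x (hC hx)).1, ?_⟩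
    ext x
    simp only [mem_singleton_iff, mem_ofPred_eq]
    exact ⟨fun h => by subst h; exact ⟨hvC, rfl⟩, fun h => (hmax x (hC h.1)).2 h.2⟩
  have hApoly : IsPolytope A := by
    classical
    exact ⟨insert v W, by rw [Finset.coe_insert]⟩
  have hCeq := convexHull_insert_inter_halfSpace_ge hfv hfW
  rw [← hA] at hCeq
  have hCpoly : IsPolytope (A ∩ {x | c ≤ f x}) := by
    classical
    exact ⟨insert v (W.image (crossing f c v)), by rw [Finset.coe_insert, Finset.coe_image, hCeq]⟩
  have hFeq : A ∩ {x | f x ≤ c} ∩ (A ∩ {x | c ≤ f x}) = {x ∈ A ∩ {x | c ≤ f x} | f x = c} := by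
    ext x
    simp only [mem_inter_iff, mem_ofPred_eq]
    exact ⟨fun h => ⟨h.2, le_antisymm h.1.2 h.2.2⟩, fun h => ⟨⟨h.1.1, h.2.le⟩, h.1⟩⟩
  have hcross : ∀ w ∈ (W : Set (Fin n → ℝ)),
      crossing f c v w ∈ A ∩ {x | f x ≤ c} ∩ (A ∩ {x | c ≤ f x}) := fun w hw => by
    have h1 := crossing_mem_convexHull hfv hfW hw
    have h2 := apply_crossing hfv (hfW w hw)
    exact ⟨⟨h1, h2.le⟩, h1, h2.ge⟩
  have hvF : v ∉ affineSpan ℝ (A ∩ {x | f x ≤ c} ∩ (A ∩ {x | c ≤ f x})) := by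
    intro hmem
    have : affineSpan ℝ (A ∩ {x | f x ≤ c} ∩ (A ∩ {x | c ≤ f x})) ≤
        (AffineSubspace.mk' c (⊥ : Submodule ℝ ℝ)).comap f.toAffineMap := by
      rw [affineSpan_le]
      rintro x ⟨⟨-, h1⟩, -, h2⟩
      simpa [AffineSubspace.mem_mk', sub_eq_zero] using le_antisymm h1 h2
    have := this hmem
    simp only [AffineSubspace.mem_comap, LinearMap.coe_toAffineMap, AffineSubspace.mem_mk',
      vsub_eq_sub, Submodule.mem_bot, sub_eq_zero] at this
    linarith
  have hCpyr : A ∩ {x | c ≤ f x} =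
      convexHull ℝ (A ∩ {x | f x ≤ c} ∩ (A ∩ {x | c ≤ f x}) ∪ {v}) := by
    apply Subset.antisymm
    · refine hCeq.subset.trans (convexHull_mono ?_)
      rintro _ (rfl | ⟨w, hw, rfl⟩)
      · exact Or.inr rfl
      · exact Or.inl (hcross w hw)
    · refine convexHull_min ?_ ((convex_convexHull ℝ _).inter (convex_halfSpace_ge f.isLinear _))
      rintro x (hx | rfl)
      · exact hx.2
      · exact ⟨hvA, hfv.le⟩
  refine ⟨hB, hApoly, inter_subset_left, fun h => ?_, A ∩ {x | c ≤ f x}, v, hCpoly, ?_, ?_, ?_,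
    hvert A subset_rfl hvA, hCpoly, ⟨-f, -c, neg_ne_zero.2 hf0, fun x hx => ?_, ?_⟩, ?_,
    hvert _ inter_subset_left ⟨hvA, hfv.le⟩, hvF, hCpyr⟩
  · have : v ∈ A ∩ {x | f x ≤ c} := h.symm.subset hvA
    exact absurd this.2 (not_le.2 hfv)
  · ext x
    simp only [mem_union, mem_inter_iff, mem_ofPred_eq]
    have := le_total (f x) c
    tauto
  · rw [polyDim, hspan, polyDim]
  · have : affineSpan ℝ (A ∩ {x | (-f) x ≤ -c}) = affineSpan ℝ A :=
      affineSpan_inter_halfSpace_le (convex_convexHull ℝ _) hvA (by simpa using hfv)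
    simp only [LinearMap.neg_apply, neg_le_neg_iff] at this
    rw [polyDim, this, polyDim]
  · simpa using hx.2
  · simpa only [LinearMap.neg_apply, neg_inj] using hFeq
  · have := polyDim_convexHull_insert ⟨_, hcross w hw⟩ hvF
    rw [← union_singleton, ← hCpyr] at this
    exact this

end Over

/-- The part of a convex hull on a supporting hyperplane. -/
theorem convexHull_inter_hyperplane {E : Type*} [AddCommGroup E] [Module ℝ E] {T : Set E}
    {g : E →ₗ[ℝ] ℝ} {b : ℝ} (hT : ∀ x ∈ T, g x ≤ b) :
    convexHull ℝ T ∩ {x | g x = b} = convexHull ℝ (T ∩ {x | g x = b}) := by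
  apply Subset.antisymm
  · rintro x ⟨hx, hxb⟩
    have key : x ∈ {x | g x < b ∨ g x = b ∧ x ∈ convexHull ℝ (T ∩ {x | g x = b})} := by
      refine convexHull_min (fun y hy => ?_) ?_ hx
      · rcases (hT y hy).lt_or_eq with h | h
        · exact Or.inl h
        · exact Or.inr ⟨h, subset_convexHull ℝ _ ⟨hy, h⟩⟩
      · refine convex_iff_forall_pos.2 fun y hy z hz s t hs ht hst => ?_
        simp only [mem_ofPred_eq, map_add, map_smul, smul_eq_mul] at hy hz ⊢
        obtain rfl : t = 1 - s := by linarith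
        rcases hy with hy | ⟨hy, hyT⟩
        · left
          have : g z ≤ b := by
            rcases hz with hz | hz
            exacts [hz.le, hz.1.le]
          nlinarith
        · rcases hz with hz | ⟨hz, hzT⟩
          · left
            nlinarith
          · right
            exact ⟨by rw [hy, hz]; ring, convex_convexHull ℝ _ hyT hzT hs.le ht.le hst⟩
    rcases key with h | h
    · exact absurd hxb h.ne
    · exact h.2
  · refine convexHull_min ?_ ((convex_convexHull ℝ _).inter (convex_hyperplane g.isLinear _))
    exact fun x hx => ⟨subset_convexHull ℝ _ hx.1, hx.2⟩

section Reach

variable {K : Subfield ℝ} {n : ℕ} {strict : Prop} {P Q X Y A B : Set (Fin n → ℝ)}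

theorem IsPolytopeOver.inter_hyperplane (hP : IsPolytopeOver K P) {g : (Fin n → ℝ) →ₗ[ℝ] ℝ}
    {b : ℝ} (hle : ∀ x ∈ P, g x ≤ b) : IsPolytopeOver K (P ∩ {x | g x = b}) := by
  obtain ⟨S, hS, rfl⟩ := hP
  rw [convexHull_inter_hyperplane fun x hx => hle x (subset_convexHull ℝ _ hx)]
  exact isPolytopeOver_of_finite (S.finite_toSet.inter_of_left _) fun x hx => hS x hx.1

theorem ReachOver.mono (hXY : X ⊆ Y) (h : ReachOver K strict X A B) :
    ReachOver K strict Y A B :=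
  Relation.ReflTransGen.mono (fun _ _ h => ⟨h.1, h.2.1.trans hXY, h.2.2⟩) _ _ h

theorem ReachOver.not_strict (h : ReachOver K True X A B) : ReachOver K False X A B := by
  refine Relation.ReflTransGen.mono (fun _ _ h => ⟨h.1, h.2.1, h.2.2.imp_left ?_⟩) _ _ h
  rintro ⟨W, v, f, c, hW, hv, hf, hc, hA, hfv, hfW, -, hB⟩
  exact ⟨W, v, f, c, hW, hv, hf, hc, hA, hfv, hfW, False.elim, hB⟩

theorem ReachOver.of_isCutOver (h : IsCutOver K strict A B) (hA : A ⊆ X) :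
    ReachOver K strict X A B :=
  Relation.ReflTransGen.single ⟨h.isPolytopeOver_right, h.subset.trans hA, Or.inl h⟩

theorem ReachOver.of_subset (hAB : A ⊆ B) (hB : IsPolytopeOver K B) (hBX : B ⊆ X) :
    ReachOver K strict X A B :=
  Relation.ReflTransGen.single ⟨hB, hBX, Or.inr hAB⟩

theorem ReachOver.isPolytopeOver (h : ReachOver K strict X A B) (hA : IsPolytopeOver K A) :
    IsPolytopeOver K B := by
  rcases Relation.ReflTransGen.cases_tail h with rfl | ⟨_, -, h⟩
  exacts [hA, h.1]

theorem ReachOver.subset (h : ReachOver K strict X A B) (hA : A ⊆ X) : B ⊆ X := by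
  rcases Relation.ReflTransGen.cases_tail h with rfl | ⟨_, -, h⟩
  exacts [hA, h.2.1]

theorem ReachOver.affineSpan_eq (h : ReachOver K True X A B)
    (hA : affineSpan ℝ A = affineSpan ℝ X) : affineSpan ℝ B = affineSpan ℝ X := by
  induction h with
  | refl => exact hA
  | tail _ h ih =>
    rcases h.2.2 with hcut | hsub
    · rw [hcut.affineSpan_eq, ih]
    · exact le_antisymm (affineSpan_mono ℝ h.2.1) (ih ▸ affineSpan_mono ℝ hsub)

/-- Moves inside a face extend to strict moves of the whole polytope. -/
theorem ReachOver.exists_of_face (hQ : IsPolytopeOver K Q) {g : (Fin n → ℝ) →ₗ[ℝ] ℝ} {b : ℝ}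
    (hg : IsFunctionalOver K g) (hb : b ∈ K) (hle : ∀ x ∈ Q, g x ≤ b)
    (hlt : ∃ x ∈ Q, g x < b) {G : Set (Fin n → ℝ)}
    (h : ReachOver K False (Q ∩ {x | g x = b}) (Q ∩ {x | g x = b}) G) :
    ∃ Q', ReachOver K True Q Q Q' ∧ Q' ∩ {x | g x = b} = G ∧ ∃ x ∈ Q', g x < b := by
  classical
  induction h with
  | refl => exact ⟨Q, Relation.ReflTransGen.refl, rfl, hlt⟩
  | @tail G₁ G₂ _ hmove ih =>
    obtain ⟨R, hQR, hRG, x₀, hx₀, hx₀b⟩ := ih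
    obtain ⟨T, hT, hTR⟩ := hQR.isPolytopeOver hQ
    have hRQ : R ⊆ Q := hQR.subset subset_rfl
    rcases hmove.2.2 with ⟨W, v, f, c, hW, hv, hf, hc, hG₁, hfv, hfW, -, hG₂⟩ | hsub
    · obtain ⟨M, hM⟩ : ∃ M : ℕ, ∀ t ∈ T.filter (fun t => g t < b), f t + M * (g t - b) < c := by
        have : ∀ t ∈ T.filter (fun t => g t < b),
            ∀ᶠ M : ℕ in Filter.atTop, f t + M * (g t - b) < c := by
          intro t ht
          have htb : 0 < b - g t := sub_pos.2 (Finset.mem_filter.1 ht).2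
          obtain ⟨N, hN⟩ := exists_nat_gt ((f t - c) / (b - g t))
          filter_upwards [Filter.eventually_ge_atTop N] with M hM
          have : (N : ℝ) ≤ M := by exact_mod_cast hM
          rw [div_lt_iff₀ htb] at hN
          nlinarith
        exact ((Filter.eventually_all_finset _).2 this).exists
      have hGgen : ∀ x ∈ insert v (W : Set (Fin n → ℝ)), x ∈ R ∧ g x = b := fun x hx => by
        have : x ∈ R ∩ {x | g x = b} := hRG ▸ hG₁ ▸ subset_convexHull ℝ _ hx
        exact this
      have hval : ∀ x, g x = b → (f + (M : ℝ) • g) x = f x + M * b := fun x hx => by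
        simp [hx]
      have hMK : (M : ℝ) ∈ K := natCast_mem K M
      have hcut : IsCutOver K True R (R ∩ {x | (f + (M : ℝ) • g) x ≤ c + M * b}) := by
        refine ⟨W ∪ T.filter (fun t => g t < b), v, f + (M : ℝ) • g, c + M * b, ?_, hv,
          fun x hx => K.add_mem (hf x hx) (K.mul_mem hMK (hg x hx)),
          K.add_mem hc (K.mul_mem hMK hb), ?_, ?_, ?_, fun _ => ?_, rfl⟩
        · intro w hw
          rcases Finset.mem_union.1 hw with hw | hw
          exacts [hW w hw, hT w (Finset.mem_filter.1 hw).1]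
        · apply Subset.antisymm
          · nth_rewrite 1 [hTR]
            refine convexHull_min (fun t ht => ?_) (convex_convexHull ℝ _)
            have htR : t ∈ R := hTR ▸ subset_convexHull ℝ _ ht
            rcases (hle t (hRQ htR)).lt_or_eq with h | h
            · exact subset_convexHull ℝ _ (mem_insert_of_mem _
                (Finset.mem_union_right _ (Finset.mem_filter.2 ⟨ht, h⟩)))
            · have : t ∈ convexHull ℝ (insert v (W : Set (Fin n → ℝ))) :=
                hG₁ ▸ hRG ▸ ⟨htR, h⟩
              refine convexHull_mono (insert_subset_insert ?_) this
              exact Finset.coe_subset.2 Finset.subset_union_left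
          · refine convexHull_min ?_ (hQR.isPolytopeOver hQ).convex
            rintro x (rfl | hx)
            · exact (hGgen _ (mem_insert _ _)).1
            rcases Finset.mem_union.1 hx with hx | hx
            · exact (hGgen x (mem_insert_of_mem _ hx)).1
            · exact hTR ▸ subset_convexHull ℝ _ (Finset.mem_filter.1 hx).1
        · rw [hval v (hGgen v (mem_insert _ _)).2]
          linarith
        · intro w hw
          rcases Finset.mem_union.1 hw with hw | hw
          · rw [hval w (hGgen w (mem_insert_of_mem _ hw)).2]
            linarith [hfW w hw]
          · have := hM w hw
            simp only [LinearMap.add_apply, LinearMap.smul_apply, smul_eq_mul]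
            linarith
        · obtain ⟨t, ht, htb⟩ : ∃ t ∈ T, g t < b := by
            by_contra! hall
            have : R ⊆ {x | b ≤ g x} := hTR ▸
              convexHull_min (fun t ht => hall t ht) (convex_halfSpace_ge g.isLinear _)
            exact absurd (this hx₀) (not_le.2 hx₀b)
          have htf : t ∈ T.filter (fun t => g t < b) := Finset.mem_filter.2 ⟨ht, htb⟩
          refine ⟨t, Finset.mem_union_right _ htf, ?_⟩
          have := hM t htf
          simp only [LinearMap.add_apply, LinearMap.smul_apply, smul_eq_mul]
          linarith
      refine ⟨_, hQR.trans (ReachOver.of_isCutOver hcut hRQ), ?_, ?_⟩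
      · rw [hG₂, ← hRG]
        ext x
        simp only [mem_inter_iff, mem_ofPred_eq]
        constructor
        · rintro ⟨⟨h1, h2⟩, h3⟩
          rw [hval x h3] at h2
          exact ⟨⟨h1, h3⟩, by linarith⟩
        · rintro ⟨⟨h1, h3⟩, h2⟩
          refine ⟨⟨h1, ?_⟩, h3⟩
          rw [hval x h3]
          linarith
      · obtain ⟨t, ht, htb⟩ : ∃ t ∈ R ∩ {x | (f + (M : ℝ) • g) x ≤ c + M * b}, g t ≠ b := by
          by_contra! hall
          have hspan : affineSpan ℝ R ≤
              (AffineSubspace.mk' b (⊥ : Submodule ℝ ℝ)).comap g.toAffineMap := by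
            rw [← hcut.affineSpan_eq, affineSpan_le]
            intro x hx
            simpa [AffineSubspace.mem_mk', sub_eq_zero] using hall x hx
          have := hspan (mem_affineSpan ℝ hx₀)
          simp only [AffineSubspace.mem_comap, LinearMap.coe_toAffineMap, AffineSubspace.mem_mk',
            vsub_eq_sub, Submodule.mem_bot, sub_eq_zero] at this
          exact hx₀b.ne this
        exact ⟨t, ht, lt_of_le_of_ne (hle t (hRQ ht.1)) htb⟩
    · obtain ⟨S, hS, hSG⟩ := hmove.1
      have hG₂Q : G₂ ⊆ Q := fun x hx => (hmove.2.1 hx).1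
      have hpoly : IsPolytopeOver K (convexHull ℝ (R ∪ G₂)) := by
        rw [hTR, hSG, convexHull_convexHull_union_left, convexHull_convexHull_union_right]
        refine isPolytopeOver_of_finite (T.finite_toSet.union S.finite_toSet) ?_
        rintro x (hx | hx)
        exacts [hT x hx, hS x hx]
      refine ⟨convexHull ℝ (R ∪ G₂), hQR.trans (ReachOver.of_subset
        (subset_union_left.trans (subset_convexHull ℝ _)) hpoly
        (convexHull_min (union_subset hRQ hG₂Q) hQ.convex)), ?_,
        x₀, subset_convexHull ℝ _ (Or.inl hx₀), hx₀b⟩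
      rw [convexHull_inter_hyperplane, union_inter_distrib_right, hRG,
        inter_eq_left.2 fun x hx => (hmove.2.1 hx).2, union_eq_right.2 hsub]
      · exact hmove.1.convex.convexHull_eq
      · rintro x (hx | hx)
        exacts [hle x (hRQ hx), hle x (hG₂Q hx)]

end Reach

/-! ### Contracting a polytope towards one of its points -/

section Contract

variable {K : Subfield ℝ} {n : ℕ} {strict : Prop} {P Q X A B : Set (Fin n → ℝ)}

theorem homothety_eq_add_smul_sub {E : Type*} [AddCommGroup E] [Module ℝ E] (p : E) (r : ℝ)
    (x : E) : AffineMap.homothety p r x = p + r • (x - p) := by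
  rw [AffineMap.homothety_apply, vsub_eq_sub, vadd_eq_add, add_comm]

theorem IsPointOver.homothety {p x : Fin n → ℝ} (hp : IsPointOver K p) {r : ℝ} (hr : r ∈ K)
    (hx : IsPointOver K x) : IsPointOver K (AffineMap.homothety p r x) := by
  rw [homothety_eq_add_smul_sub]
  exact hp.add ((hx.sub hp).smul hr)

theorem IsPolytopeOver.image_homothety {p : Fin n → ℝ} (hp : IsPointOver K p) {r : ℝ}
    (hr : r ∈ K) (hP : IsPolytopeOver K P) : IsPolytopeOver K (AffineMap.homothety p r '' P) := by
  obtain ⟨S, hS, rfl⟩ := hP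
  rw [AffineMap.image_convexHull]
  refine isPolytopeOver_of_finite (S.finite_toSet.image _) ?_
  rintro _ ⟨x, hx, rfl⟩
  exact hp.homothety hr (hS x hx)

theorem IsCutOver.image_homothety {p : Fin n → ℝ} (hp : IsPointOver K p) {r : ℝ}
    (hr : r ∈ K) (hr0 : 0 < r) (h : IsCutOver K strict A B) :
    IsCutOver K strict (AffineMap.homothety p r '' A) (AffineMap.homothety p r '' B) := by
  classical
  obtain ⟨W, v, f, c, hW, hv, hf, hc, rfl, hfv, hfW, hstrict, rfl⟩ := h
  have hval : ∀ x, f (AffineMap.homothety p r x) = f p + r * (f x - f p) := fun x => by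
    simp [homothety_eq_add_smul_sub]
  have hle : ∀ x, f (AffineMap.homothety p r x) ≤ f p + r * (c - f p) ↔ f x ≤ c := fun x => by
    rw [hval, add_le_add_iff_left, mul_le_mul_iff_of_pos_left hr0, sub_le_sub_iff_right]
  refine ⟨W.image (AffineMap.homothety p r), AffineMap.homothety p r v, f, f p + r * (c - f p),
    ?_, hp.homothety hr hv, hf, K.add_mem (hf p hp) (K.mul_mem hr (K.sub_mem hc (hf p hp))),
    ?_, ?_, ?_, fun hs => ?_, ?_⟩
  · intro x hx
    obtain ⟨w, hw, rfl⟩ := Finset.mem_image.1 hx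
    exact hp.homothety hr (hW w hw)
  · rw [AffineMap.image_convexHull, image_insert_eq, Finset.coe_image]
  · exact not_le.1 fun h => (not_le.2 hfv) ((hle v).1 h)
  · intro x hx
    obtain ⟨w, hw, rfl⟩ := Finset.mem_image.1 hx
    exact (hle w).2 (hfW w hw)
  · obtain ⟨w, hw, hwc⟩ := hstrict hs
    refine ⟨_, Finset.mem_image_of_mem _ hw, ?_⟩
    rw [hval]
    nlinarith
  · ext x
    constructor
    · rintro ⟨x, ⟨hx, hxc⟩, rfl⟩
      exact ⟨mem_image_of_mem _ hx, (hle x).2 hxc⟩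
    · rintro ⟨⟨x, hx, rfl⟩, hxc⟩
      exact mem_image_of_mem _ ⟨hx, (hle x).1 hxc⟩

theorem ReachOver.image_homothety {p : Fin n → ℝ} (hp : IsPointOver K p) {r : ℝ}
    (hr : r ∈ K) (hr0 : 0 < r) (h : ReachOver K strict X A B) :
    ReachOver K strict (AffineMap.homothety p r '' X) (AffineMap.homothety p r '' A)
      (AffineMap.homothety p r '' B) :=
  Relation.ReflTransGen.lift (AffineMap.homothety p r '' ·)
    (fun _ _ h => ⟨h.1.image_homothety hp hr, image_mono h.2.1,
      h.2.2.imp (fun h => h.image_homothety hp hr hr0) image_mono⟩) _ _ h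

theorem finrank_vectorSpan_inter_hyperplane_lt {g : (Fin n → ℝ) →ₗ[ℝ] ℝ} {b : ℝ}
    {p : Fin n → ℝ} (hp : p ∈ P) (hpb : g p ≠ b) (hne : (P ∩ {x | g x = b}).Nonempty) :
    Module.finrank ℝ (vectorSpan ℝ (P ∩ {x | g x = b})) <
      Module.finrank ℝ (vectorSpan ℝ P) := by
  obtain ⟨q, hq, hqb⟩ := hne
  refine Submodule.finrank_lt_finrank_of_lt
    (lt_of_le_of_ne (vectorSpan_mono ℝ inter_subset_left) fun h => hpb ?_)
  have hker : vectorSpan ℝ (P ∩ {x | g x = b}) ≤ LinearMap.ker g := by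
    rw [vectorSpan_def, Submodule.span_le]
    rintro _ ⟨x, hx, y, hy, rfl⟩
    simp only [vsub_eq_sub, SetLike.mem_coe, LinearMap.mem_ker, map_sub]
    rw [hx.2, hy.2, sub_self]
  have := hker (h ▸ vsub_mem_vectorSpan ℝ hp hq)
  rw [vsub_eq_sub, LinearMap.mem_ker, map_sub, sub_eq_zero] at this
  exact this.trans hqb

/-- If lower-dimensional polytopes can be cut down to nothing, then a polytope can be detached
from finitely many supporting hyperplanes not containing a given point `p`. -/
theorem IsPolytopeOver.exists_reachOver_lt (hP : IsPolytopeOver K P)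
    (hempty : ∀ G : Set (Fin n → ℝ), IsPolytopeOver K G →
      Module.finrank ℝ (vectorSpan ℝ G) < Module.finrank ℝ (vectorSpan ℝ P) →
      ReachOver K False G G ∅)
    {p : Fin n → ℝ} (hp : p ∈ P) (J : Finset (((Fin n → ℝ) →ₗ[ℝ] ℝ) × ℝ))
    (hJ : ∀ j ∈ J, IsFunctionalOver K j.1 ∧ j.2 ∈ K) (hle : ∀ j ∈ J, ∀ x ∈ P, j.1 x ≤ j.2) :
    ∃ Q, ReachOver K True P P Q ∧ ∀ j ∈ J, j.1 p = j.2 ∨ ∀ q ∈ Q, j.1 q < j.2 := by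
  classical
  induction J using Finset.induction_on with
  | empty => exact ⟨P, Relation.ReflTransGen.refl, by simp⟩
  | insert j J _ ih =>
    obtain ⟨Q, hPQ, hQ⟩ := ih (fun i hi => hJ i (Finset.mem_insert_of_mem hi))
      (fun i hi => hle i (Finset.mem_insert_of_mem hi))
    have hQP : Q ⊆ P := hPQ.subset subset_rfl
    have hQle : ∀ x ∈ Q, j.1 x ≤ j.2 := fun x hx => hle j (Finset.mem_insert_self _ _) x (hQP hx)
    obtain ⟨hjf, hjb⟩ := hJ j (Finset.mem_insert_self _ _)
    by_cases hpj : j.1 p = j.2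
    · refine ⟨Q, hPQ, fun i hi => ?_⟩
      rcases Finset.mem_insert.1 hi with rfl | hi
      exacts [Or.inl hpj, hQ i hi]
    have hQpoly := hPQ.isPolytopeOver hP
    have hG : ReachOver K False (Q ∩ {x | j.1 x = j.2}) (Q ∩ {x | j.1 x = j.2}) ∅ := by
      rcases (Q ∩ {x | j.1 x = j.2}).eq_empty_or_nonempty with h | h
      · rw [h]
        exact Relation.ReflTransGen.refl
      · refine hempty _ (hQpoly.inter_hyperplane hQle) (lt_of_le_of_lt ?_
          (finrank_vectorSpan_inter_hyperplane_lt hp hpj (h.mono (inter_subset_inter_left _ hQP))))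
        exact Submodule.finrank_mono (vectorSpan_mono ℝ (inter_subset_inter_left _ hQP))
    have hlt : ∃ x ∈ Q, j.1 x < j.2 := by
      by_contra! hall
      have hspan : affineSpan ℝ Q ≤
          (AffineSubspace.mk' j.2 (⊥ : Submodule ℝ ℝ)).comap j.1.toAffineMap := by
        rw [affineSpan_le]
        intro x hx
        simpa [AffineSubspace.mem_mk', sub_eq_zero] using le_antisymm (hQle x hx) (hall x hx)
      have := hspan ((hPQ.affineSpan_eq rfl).symm ▸ mem_affineSpan ℝ hp)
      simp only [AffineSubspace.mem_comap, LinearMap.coe_toAffineMap, AffineSubspace.mem_mk',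
        vsub_eq_sub, Submodule.mem_bot, sub_eq_zero] at this
      exact hpj this
    obtain ⟨Q', hQQ', hQ'G, -⟩ := ReachOver.exists_of_face hQpoly hjf hjb hQle hlt hG
    have hQ'Q : Q' ⊆ Q := hQQ'.subset subset_rfl
    refine ⟨Q', hPQ.trans (hQQ'.mono hQP), fun i hi => ?_⟩
    rcases Finset.mem_insert.1 hi with rfl | hi
    · refine Or.inr fun q hq => lt_of_le_of_ne (hQle q (hQ'Q hq)) fun h => ?_
      have : q ∈ Q' ∩ {x | i.1 x = i.2} := ⟨hq, h⟩
      rw [hQ'G] at this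
      exact this
    · exact (hQ i hi).imp_right fun h q hq => h q (hQ'Q hq)

theorem IsPolytopeOver.exists_reachOver_homothety (hP : IsPolytopeOver K P)
    (hempty : ∀ G : Set (Fin n → ℝ), IsPolytopeOver K G →
      Module.finrank ℝ (vectorSpan ℝ G) < Module.finrank ℝ (vectorSpan ℝ P) →
      ReachOver K False G G ∅)
    {p : Fin n → ℝ} (hp : p ∈ P) (hpK : IsPointOver K p) :
    ∃ r ∈ K, 0 < r ∧ r < 1 ∧ ReachOver K True P P (AffineMap.homothety p r '' P) := by
  obtain ⟨J, hJ, hJP⟩ := hP.exists_halfspaces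
  obtain ⟨Q, hPQ, hQ⟩ := hP.exists_reachOver_lt hempty hp J hJ fun j hj x hx => (hJP x).1 hx j hj
  have hQP : Q ⊆ P := hPQ.subset subset_rfl
  obtain ⟨T, hT, hTQ⟩ := hPQ.isPolytopeOver hP
  obtain ⟨m, hm⟩ : ∃ m : ℕ, ∀ t ∈ T, t + (1 / ((m : ℝ) + 1)) • (t - p) ∈ P := by
    have : ∀ t ∈ T, ∀ᶠ m : ℕ in Filter.atTop, t + (1 / ((m : ℝ) + 1)) • (t - p) ∈ P := by
      intro t ht
      have htQ : t ∈ Q := hTQ ▸ subset_convexHull ℝ _ ht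
      simp only [hJP, map_add, map_smul, map_sub, smul_eq_mul]
      refine (Filter.eventually_all_finset _).2 fun j hj => ?_
      rcases hQ j hj with h | h
      · refine Filter.Eventually.of_forall fun m => ?_
        have h1 := (hJP t).1 (hQP htQ) j hj
        have h2 : (0 : ℝ) ≤ 1 / ((m : ℝ) + 1) := by positivity
        rw [h]
        nlinarith [mul_nonneg h2 (sub_nonneg.2 h1)]
      · have hlim := (tendsto_one_div_add_atTop_nhds_zero_nat (𝕜 := ℝ)).mul_const (j.1 t - j.1 p)
        have hlim' := hlim.const_add (j.1 t)
        rw [zero_mul, add_zero] at hlim'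
        exact (hlim'.eventually_lt_const (h t htQ)).mono fun _ h => h.le
    exact ((Filter.eventually_all_finset _).2 this).exists
  set δ : ℝ := 1 / ((m : ℝ) + 1) with hδ
  have hδ0 : 0 < δ := by positivity
  have hδK : δ ∈ K := K.div_mem K.one_mem (K.add_mem (natCast_mem K m) K.one_mem)
  have hrK : (1 + δ)⁻¹ ∈ K := K.inv_mem (K.add_mem K.one_mem hδK)
  have hr0 : 0 < (1 + δ)⁻¹ := by positivity
  have hr1 : (1 + δ)⁻¹ < 1 := inv_lt_one_of_one_lt₀ (by linarith)
  refine ⟨_, hrK, hr0, hr1, hPQ.trans (ReachOver.of_subset ?_ (hP.image_homothety hpK hrK) ?_)⟩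
  · rw [hTQ]
    refine convexHull_min (fun t ht => ⟨_, hm t ht, ?_⟩) (hP.convex.affine_image _)
    have : t + δ • (t - p) - p = (1 + δ) • (t - p) := by
      rw [add_smul, one_smul]
      abel
    rw [homothety_eq_add_smul_sub, this, smul_smul, inv_mul_cancel₀ (by positivity), one_smul,
      add_sub_cancel]
  · rintro _ ⟨x, hx, rfl⟩
    rw [homothety_eq_add_smul_sub]
    exact hP.convex.add_smul_sub_mem hp hx ⟨hr0.le, hr1.le⟩

theorem IsPolytopeOver.exists_reachOver_subset (hP : IsPolytopeOver K P)
    (hempty : ∀ G : Set (Fin n → ℝ), IsPolytopeOver K G →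
      Module.finrank ℝ (vectorSpan ℝ G) < Module.finrank ℝ (vectorSpan ℝ P) →
      ReachOver K False G G ∅)
    {p : Fin n → ℝ} (hp : p ∈ P) (hpK : IsPointOver K p) {C : Set (Fin n → ℝ)}
    (hC : Convex ℝ C)
    (hCP : ∀ x ∈ P, ∀ᶠ t in nhdsWithin (0 : ℝ) (Ioi 0), AffineMap.homothety p t x ∈ C) :
    ∃ Q, ReachOver K True P P Q ∧ Q ⊆ C := by
  obtain ⟨r, hrK, hr0, hr1, hr⟩ := hP.exists_reachOver_homothety hempty hp hpK
  have hpow : ∀ N : ℕ, ReachOver K True P P (AffineMap.homothety p (r ^ N) '' P) := by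
    intro N
    induction N with
    | zero =>
      simp only [pow_zero, AffineMap.homothety_one, AffineMap.coe_id, image_id]
      exact Relation.ReflTransGen.refl
    | succ N ih =>
      have := hr.image_homothety hpK (K.pow_mem hrK N) (pow_pos hr0 N)
      rw [← image_comp, ← AffineMap.coe_comp, ← AffineMap.homothety_mul, ← pow_succ] at this
      exact ih.trans (this.mono (ih.subset subset_rfl))
  obtain ⟨S, -, hS⟩ := id hP
  have hlim : Filter.Tendsto (fun N : ℕ => r ^ N) Filter.atTop (nhdsWithin (0 : ℝ) (Ioi 0)) :=
    tendsto_nhdsWithin_iff.2 ⟨tendsto_pow_atTop_nhds_zero_of_lt_one hr0.le hr1,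
      Filter.Eventually.of_forall fun N => pow_pos hr0 N⟩
  obtain ⟨N, hN⟩ := ((Filter.eventually_all_finset S).2 fun x hx =>
    hlim.eventually (hCP x (hS ▸ subset_convexHull ℝ _ hx))).exists
  refine ⟨_, hpow N, ?_⟩
  rw [hS, AffineMap.image_convexHull]
  refine convexHull_min ?_ hC
  rintro _ ⟨x, hx, rfl⟩
  exact hN x hx

/-- A simplex can be cut down to nothing. -/
theorem reachOver_empty_of_notMem_affineSpan (S : Finset (Fin n → ℝ))
    (hS : ∀ x ∈ S, IsPointOver K x)
    (hindep : ∀ s ∈ S, s ∉ affineSpan ℝ ((S : Set (Fin n → ℝ)) \ {s}))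
    (hX : convexHull ℝ (S : Set (Fin n → ℝ)) ⊆ X) :
    ReachOver K False X (convexHull ℝ (S : Set (Fin n → ℝ))) ∅ := by
  classical
  induction S using Finset.induction_on with
  | empty =>
    rw [Finset.coe_empty, convexHull_empty]
    exact Relation.ReflTransGen.refl
  | insert s S hs ih =>
    have hSK : ∀ x ∈ S, IsPointOver K x := fun x hx => hS x (Finset.mem_insert_of_mem hx)
    have hsub : (S : Set (Fin n → ℝ)) ⊆ (insert s S : Finset _) :=
      Finset.coe_subset.2 (Finset.subset_insert _ _)
    have hsS : s ∉ affineSpan ℝ (S : Set (Fin n → ℝ)) := by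
      have := hindep s (Finset.mem_insert_self _ _)
      rwa [Finset.coe_insert, insert_sdiff_self_of_notMem (by simpa using hs)] at this
    obtain ⟨f, c, hf, hc, hfs, hfS⟩ := exists_functionalOver_of_notMem_affineSpan hSK hsS
    have hcut : IsCutOver K False (convexHull ℝ ((insert s S : Finset _) : Set (Fin n → ℝ)))
        (convexHull ℝ (S : Set (Fin n → ℝ))) := by
      refine ⟨S, s, f, c, hSK, hS s (Finset.mem_insert_self _ _), hf, hc,
        by rw [Finset.coe_insert], hfs, fun x hx => (hfS x hx).le, False.elim, ?_⟩
      rw [Finset.coe_insert, convexHull_insert_inter_halfSpace_le hfs fun x hx => (hfS x hx).le]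
      congr 1
      refine (union_eq_left.2 ?_).symm
      rintro _ ⟨x, hx, rfl⟩
      have : f s - c ≠ 0 := by linarith
      rw [crossing, hfS x hx, div_self this, one_smul, add_sub_cancel]
      exact hx
    refine (ReachOver.of_isCutOver hcut hX).trans
      (ih hSK (fun x hx h => ?_) ((convexHull_mono hsub).trans hX))
    exact hindep x (Finset.mem_insert_of_mem hx)
      (affineSpan_mono ℝ (sdiff_subset_sdiff_left hsub) h)

theorem eventually_homothety_centroid_mem_convexHull {E : Type*} [AddCommGroup E] [Module ℝ E]
    {S : Finset E} (hS : S.Nonempty) {x : E} (hx : x ∈ affineSpan ℝ (S : Set E)) :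
    ∀ᶠ t in nhdsWithin (0 : ℝ) (Ioi 0),
      AffineMap.homothety ((S.card : ℝ)⁻¹ • ∑ s ∈ S, s) t x ∈ convexHull ℝ (S : Set E) := by
  classical
  have hcard : (0 : ℝ) < S.card := by exact_mod_cast hS.card_pos
  obtain ⟨w, hw, rfl⟩ : ∃ w : E → ℝ, ∑ s ∈ S, w s = 1 ∧ x = ∑ s ∈ S, w s • s := by
    have hx' : x ∈ affineSpan ℝ (range ((↑) : S → E)) := by simpa using hx
    obtain ⟨w, hw, hxw⟩ := eq_affineCombination_of_mem_affineSpan_of_fintype hx'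
    rw [Finset.affineCombination_eq_linear_combination _ _ _ hw] at hxw
    refine ⟨fun s => if h : s ∈ S then w ⟨s, h⟩ else 0, ?_, ?_⟩
    · rw [← Finset.sum_coe_sort]
      simpa using hw
    · rw [hxw, ← Finset.sum_coe_sort S fun s => (if h : s ∈ S then w ⟨s, h⟩ else 0) • s]
      exact Finset.sum_congr rfl fun s _ => by simp
  have hev : ∀ s ∈ S, ∀ᶠ t in nhdsWithin (0 : ℝ) (Ioi 0),
      0 < (1 - t) * (S.card : ℝ)⁻¹ + t * w s := by
    intro s _
    have hcont : Continuous fun t : ℝ => (1 - t) * (S.card : ℝ)⁻¹ + t * w s := by fun_prop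
    refine (hcont.continuousAt.eventually (lt_mem_nhds ?_)).filter_mono nhdsWithin_le_nhds
    simpa using hcard
  filter_upwards [(Filter.eventually_all_finset S).2 hev] with t ht
  have e : AffineMap.homothety ((S.card : ℝ)⁻¹ • ∑ s ∈ S, s) t (∑ s ∈ S, w s • s) =
      ∑ s ∈ S, ((1 - t) * (S.card : ℝ)⁻¹ + t * w s) • s := by
    simp only [homothety_eq_add_smul_sub, add_smul, Finset.sum_add_distrib, mul_smul,
      ← Finset.smul_sum]
    rw [← Finset.smul_sum, sub_smul, one_smul, smul_sub]
    abel
  rw [e]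
  refine (convex_convexHull ℝ _).sum_mem (fun s hs => (ht s hs).le) ?_
    fun s hs => subset_convexHull ℝ _ hs
  rw [Finset.sum_add_distrib, ← Finset.mul_sum, ← Finset.mul_sum, hw, Finset.sum_const, nsmul_eq_mul]
  field_simp
  ring

/-- Every polytope can be cut down to nothing if cuts may lower the dimension. -/
theorem IsPolytopeOver.reachOver_empty (hP : IsPolytopeOver K P) : ReachOver K False P P ∅ := by
  classical
  induction hd : Module.finrank ℝ (vectorSpan ℝ P) using Nat.strong_induction_on generalizing P with
  | _ d ih =>
  subst hd
  rcases P.eq_empty_or_nonempty with rfl | hne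
  · exact Relation.ReflTransGen.refl
  obtain ⟨V, hV, hVP⟩ := id hP
  obtain ⟨S, hSV, hspan, hindep⟩ := exists_affineIndependent ℝ (Fin n → ℝ)
    (V : Set (Fin n → ℝ))
  lift S to Finset (Fin n → ℝ) using V.finite_toSet.subset hSV
  have hSK : ∀ x ∈ S, IsPointOver K x := fun x hx => hV x (hSV hx)
  have hPspan : affineSpan ℝ P = affineSpan ℝ (S : Set (Fin n → ℝ)) := by
    rw [hspan, hVP, affineSpan_convexHull]
  have hSne : S.Nonempty := by
    have := (affineSpan_nonempty ℝ).2 hne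
    rw [hPspan] at this
    exact Finset.coe_nonempty.1 ((affineSpan_nonempty ℝ).1 this)
  have hSP : convexHull ℝ (S : Set (Fin n → ℝ)) ⊆ P := hVP ▸ convexHull_mono hSV
  have hcard : (0 : ℝ) < S.card := by exact_mod_cast hSne.card_pos
  have hpS : (S.card : ℝ)⁻¹ • ∑ s ∈ S, s ∈ convexHull ℝ (S : Set (Fin n → ℝ)) := by
    rw [Finset.smul_sum]
    refine (convex_convexHull ℝ _).sum_mem (fun _ _ => by positivity) ?_
      fun s hs => subset_convexHull ℝ _ hs
    rw [Finset.sum_const, nsmul_eq_mul, mul_inv_cancel₀ hcard.ne']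
  have hpK : IsPointOver K ((S.card : ℝ)⁻¹ • ∑ s ∈ S, s) := fun i => by
    rw [Pi.smul_apply, Finset.sum_apply]
    exact K.mul_mem (K.inv_mem (natCast_mem K _)) (K.sum_mem fun s hs => hSK s hs i)
  obtain ⟨Q, hPQ, hQ⟩ := hP.exists_reachOver_subset (fun G hG hlt => ih _ hlt hG rfl) (hSP hpS)
    hpK (convex_convexHull ℝ (S : Set (Fin n → ℝ))) fun x hx =>
      eventually_homothety_centroid_mem_convexHull hSne (hPspan ▸ mem_affineSpan ℝ hx)
  refine (hPQ.not_strict.trans (ReachOver.of_subset hQ ⟨S, hSK, rfl⟩ hSP)).trans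
    (reachOver_empty_of_notMem_affineSpan S hSK (fun s hs => ?_) hSP)
  have := hindep.notMem_affineSpan_sdiff ⟨s, hs⟩ univ
  simpa [image_sdiff Subtype.val_injective] using this

/-- Points over `K` are dense in a polytope over `K`. -/
theorem IsPolytopeOver.subset_closure (hP : IsPolytopeOver K P) :
    P ⊆ closure (P ∩ {x | IsPointOver K x}) := by
  have hPc := hP.convex
  obtain ⟨S, hS, hSP⟩ := hP
  have hdense : Dense (K : Set ℝ) := Rat.isDenseEmbedding_coe_real.dense.mono <| by
    rintro _ ⟨q, rfl⟩
    exact SubfieldClass.ratCast_mem K q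
  refine hSP.subset.trans (convexHull_min (fun x hx => _root_.subset_closure
    ⟨hSP.superset (subset_convexHull ℝ _ hx), hS x hx⟩) ?_)
  refine convex_iff_forall_pos.2 fun x hx y hy a b ha hb hab => ?_
  obtain rfl : b = 1 - a := by linarith
  have hK : ∀ t ∈ Ioo (0 : ℝ) 1 ∩ K,
      t • x + (1 - t) • y ∈ closure (P ∩ {x | IsPointOver K x}) := by
    rintro t ⟨⟨ht0, ht1⟩, htK⟩
    refine map_mem_closure₂ (f := fun x y => t • x + (1 - t) • y) (by fun_prop) hx hy ?_
    rintro x ⟨hxP, hxK⟩ y ⟨hyP, hyK⟩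
    exact ⟨hPc hxP hyP ht0.le (sub_nonneg.2 ht1.le) (by ring),
      (hxK.smul htK).add (hyK.smul (K.sub_mem K.one_mem htK))⟩
  have hcl := map_mem_closure (f := fun t : ℝ => t • x + (1 - t) • y) (by fun_prop)
    (hdense.open_subset_closure_inter isOpen_Ioo ⟨ha, by linarith⟩) hK
  rwa [closure_closure] at hcl

/-- A polytope can be cut into any relatively open subset. -/
theorem IsPolytopeOver.exists_reachOver_subset_open (hP : IsPolytopeOver K P)
    {V : Set (Fin n → ℝ)} (hV : IsOpen V) (hne : (V ∩ P).Nonempty) :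
    ∃ Q, ReachOver K True P P Q ∧ Q ⊆ V ∩ P := by
  obtain ⟨u, huV, huP⟩ := hne
  obtain ⟨p, hpV, hpP, hpK⟩ := mem_closure_iff.1 (hP.subset_closure huP) V hV huV
  obtain ⟨ε, hε, hball⟩ := Metric.isOpen_iff.1 hV p hpV
  obtain ⟨Q, hPQ, hQ⟩ := hP.exists_reachOver_subset (fun G hG _ => hG.reachOver_empty) hpP hpK
    (convex_ball p ε) fun x _ => by
      have hcont : Continuous fun t : ℝ => AffineMap.homothety p t x := by
        simp only [homothety_eq_add_smul_sub]
        fun_prop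
      refine (hcont.continuousAt.eventually (Metric.isOpen_ball.mem_nhds ?_)).filter_mono
        nhdsWithin_le_nhds
      simpa [homothety_eq_add_smul_sub] using hε
  exact ⟨Q, hPQ, fun x hx => ⟨hball (hQ hx), hPQ.subset subset_rfl hx⟩⟩

/-- A chain of strict moves gives an eventually constant admissible sequence. -/
theorem ReachOver.exists_seq (h : ReachOver K True X A B) (hA : IsPolytopeOver K A)
    (hAX : A ⊆ X) :
    ∃ Ps : ℕ → Set (Fin n → ℝ), Ps 0 = A ∧
      (∀ k, IsPolytopeOver K (Ps k) ∧ Ps k ⊆ X ∧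
        (IsPyramidalExtension (Ps (k + 1)) (Ps k) ∨ Ps k ⊆ Ps (k + 1))) ∧
      ∃ j₀, ∀ j ≥ j₀, Ps j = B := by
  induction h using Relation.ReflTransGen.head_induction_on with
  | refl => exact ⟨fun _ => B, rfl, fun _ => ⟨hA, hAX, Or.inr subset_rfl⟩, 0, fun _ _ => rfl⟩
  | @head A C hmove _ ih =>
    obtain ⟨Ps, hPs0, hPs, j₀, hj₀⟩ := ih hmove.1 hmove.2.1
    refine ⟨fun k => k.casesOn A Ps, rfl, fun k => ?_, j₀ + 1, fun j hj => ?_⟩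
    · cases k with
      | zero =>
        refine ⟨hA, hAX, ?_⟩
        change IsPyramidalExtension (Ps 0) A ∨ A ⊆ Ps 0
        rw [hPs0]
        exact hmove.2.2.imp_left IsCutOver.isPyramidalExtension
      | succ k => exact hPs k
    · cases j with
      | zero => omega
      | succ j => exact hj₀ j (by omega)

end Contract

/-- If `U` is a nonempty relatively open subset of a polytope
`P ⊆ ℝⁿ` then there is an admissible sequence of polytopes `P = P₀, P₁, …` with
`P_j ⊆ U` for all sufficiently large `j`; moreover, if `P` is rational then all the
`P_j` can be chosen rational. -/
theorem admissible_sequence_into_open_subset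
    {n : ℕ} (P U : Set (Fin n → ℝ)) (hP : IsPolytope P)
    (hUP : U ⊆ P) (hUopen : ∃ V : Set (Fin n → ℝ), IsOpen V ∧ U = V ∩ P)
    (hUne : U.Nonempty) :
    ∃ Ps : ℕ → Set (Fin n → ℝ), IsAdmissibleSeq P Ps ∧
      (∃ j₀ : ℕ, ∀ j ≥ j₀, Ps j ⊆ U) ∧
      (IsRationalPolytope P → ∀ j : ℕ, IsRationalPolytope (Ps j)) := by
  obtain ⟨V, hV, rfl⟩ := hUopen
  have key : ∀ K : Subfield ℝ, IsPolytopeOver K P → ∃ Ps : ℕ → Set (Fin n → ℝ),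
      IsAdmissibleSeq P Ps ∧ (∃ j₀ : ℕ, ∀ j ≥ j₀, Ps j ⊆ V ∩ P) ∧
      ∀ j, IsPolytopeOver K (Ps j) := by
    intro K hK
    obtain ⟨Q, hPQ, hQ⟩ := hK.exists_reachOver_subset_open hV hUne
    obtain ⟨Ps, hPs0, hPs, j₀, hj₀⟩ := hPQ.exists_seq hK subset_rfl
    exact ⟨Ps, ⟨hPs0, fun k => ⟨(hPs k).1.isPolytope, (hPs k).2⟩⟩,
      ⟨j₀, fun j hj => hj₀ j hj ▸ hQ⟩, fun j => (hPs j).1⟩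
  by_cases hrat : IsRationalPolytope P
  · obtain ⟨Ps, hadm, hsub, hPs⟩ := key _ hrat.isPolytopeOver
    exact ⟨Ps, hadm, hsub, fun _ j => (hPs j).isRationalPolytope⟩
  · obtain ⟨Ps, hadm, hsub, -⟩ := key _ hP.isPolytopeOver_top
    exact ⟨Ps, hadm, hsub, fun h => absurd h hrat⟩
end

section
/- The relation ⪯ on the set of i-sequences, defined by: σ ⪯ σ′ if and only if either σ′ has strictly more '+'-s than σ, or σ′ and σ have the same number of '+'-s and σ′ is obtained from σ by a (possibly empty) finite series of transformations, is a partial order (reflexive, transitive, and antisymmetric). -/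
/-! # Statement 3

Lemma `order` of Gubeladze, "The nilpotence conjecture in K-theory of toric
varieties": the relation `⪯` on `i`-sequences is a partial order.

We model the paper's `i`-sequences (`i ≥ 1`) as functions `Fin (i + 2) → Bool`
(`true` = `+`, `false` = `−`), i.e. the paper's `i` is `i + 1` here, so that `i` may
range over all of `ℕ`.  Entries are read cyclically. -/

/-- The cyclic entry `s_{⟨q⟩_{j+1}}` of a sequence of length `j + 1`. -/
def cyc {j : ℕ} (σ : Fin (j + 1) → Bool) (q : ℕ) : Bool :=
  σ ⟨q % (j + 1), Nat.mod_lt q (Nat.succ_pos j)⟩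

/-- `(q, r)` represents a cluster of the sequence `σ` (of length `j + 1`): a maximal
run `s_q, …, s_r = +` (cyclic enumeration) within the window `0 ≤ q ≤ r ≤ 2j − 1`,
`q ≤ j`; maximality amounts to `s_{q−1} = s_{r+1} = −` cyclically. -/
def IsCluster {j : ℕ} (σ : Fin (j + 1) → Bool) (q r : ℕ) : Prop :=
  q ≤ r ∧ r ≤ 2 * j - 1 ∧ q ≤ j ∧
  (∀ u, q ≤ u → u ≤ r → cyc σ u = true) ∧
  cyc σ (q + j) = false ∧ cyc σ (r + 1) = false

/-- `(l, r)` represents the initial cluster `σ_ini` of `σ`: the cluster with the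
smallest possible starting index `l = l(σ)` (then `r = r(σ)`). -/
def IsIni {j : ℕ} (σ : Fin (j + 1) → Bool) (l r : ℕ) : Prop :=
  IsCluster σ l r ∧ ∀ l' r', IsCluster σ l' r' → l ≤ l'

/-- Renumbering of positions after deleting the entry at position `pos`. -/
def delMap (pos u : ℕ) : ℕ := if u < pos then u else u - 1

/-- Deleting the entry at actual position `pos` from a sequence of length `j + 2`. -/
def deleteEntry {j : ℕ} (σ : Fin (j + 2) → Bool) (pos : ℕ) : Fin (j + 1) → Bool :=
  fun u => if (u : ℕ) < pos then σ ⟨u, Nat.lt_succ_of_lt u.isLt⟩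
           else σ ⟨(u : ℕ) + 1, Nat.succ_lt_succ u.isLt⟩

/-- Inserting one `+` at position `p` into a sequence of length `m + 1` (for `p ≤ m + 1`;
entries from position `p` onwards are shifted to the right). -/
def insertPlus {m : ℕ} (c : Fin (m + 1) → Bool) (p : ℕ) : Fin (m + 2) → Bool :=
  fun u => if h1 : (u : ℕ) < p then
             (if h2 : (u : ℕ) < m + 1 then c ⟨u, h2⟩ else true)
           else if (u : ℕ) = p then true
           else c ⟨(u : ℕ) - 1, by have := u.isLt; omega⟩

/-- `σ` admits a contraction obtained by deleting the entry at actual position `pos`: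
either the deleted entry is a `−`; or it is a `+` of window index `d ≠ 0, q, i + 2`
in a cluster `(+_q, …, +_r)` different from `σ_ini` with `q < i + 1` and `q < r`; or it
is a `+` of window index `d ≠ i + 2` in a cluster `(+_{i+1}, …, +_r)` different from
`σ_ini` with `i + 1 < r`. -/
def IsContractionAt {i : ℕ} (σ : Fin (i + 2) → Bool) (pos : ℕ) : Prop :=
  (∃ hp : pos < i + 2, σ ⟨pos, hp⟩ = false) ∨
  (∃ d q r, pos = d % (i + 2) ∧ IsCluster σ q r ∧ ¬ IsIni σ q r ∧
      q < i + 1 ∧ q < r ∧ q ≤ d ∧ d ≤ r ∧ d ≠ 0 ∧ d ≠ q ∧ d ≠ i + 2) ∨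
  (∃ d r, pos = d % (i + 2) ∧ IsCluster σ (i + 1) r ∧ ¬ IsIni σ (i + 1) r ∧
      i + 1 < r ∧ i + 1 ≤ d ∧ d ≤ r ∧ d ≠ i + 2)

/-- `τ` is a transformation of `σ`: either both are the constant sequence `(+, …, +)`
(the only transformation of itself), or `σ` has an initial cluster `(l, …, r)`
(equivalently `0 ≤ δ(σ) < i + 1`) and `τ` is obtained from `σ` by a contraction
(deleting the entry at position `pos`) followed by inserting one `+` immediately to
the right of the image of `+_{r(σ)}` in the contraction. -/
def IsTransf {i : ℕ} (σ τ : Fin (i + 2) → Bool) : Prop :=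
  (σ = (fun _ => true) ∧ τ = (fun _ => true)) ∨
  (∃ pos l r, IsContractionAt σ pos ∧ IsIni σ l r ∧
      τ = insertPlus (deleteEntry σ pos) (delMap pos (r % (i + 2)) + 1))

/-- The number of `+`-s of an `i`-sequence. -/
def plusCount {i : ℕ} (σ : Fin (i + 2) → Bool) : ℕ :=
  (Finset.univ.filter fun u => σ u = true).card

/-- The relation `⪯`: `σ ⪯ σ'` iff either `σ'` has strictly more `+`-s than `σ`, or
they have the same number of `+`-s and `σ'` is obtained from `σ` by a (possibly empty)
finite series of transformations. -/
def SeqPreceq {i : ℕ} (σ σ' : Fin (i + 2) → Bool) : Prop :=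
  plusCount σ < plusCount σ' ∨
  (plusCount σ = plusCount σ' ∧ Relation.ReflTransGen IsTransf σ σ')

theorem cyc_of_lt {j : ℕ} (σ : Fin (j + 1) → Bool) {u : ℕ} (h : u < j + 1) :
    cyc σ u = σ ⟨u, h⟩ := by
  simp only [cyc, Nat.mod_eq_of_lt h]

theorem cyc_add_length {j : ℕ} (σ : Fin (j + 1) → Bool) (u : ℕ) :
    cyc σ (u + (j + 1)) = cyc σ u := by
  simp only [cyc, Nat.add_mod_right]

/-- The cyclic predecessor of a positive index is the ordinary predecessor. -/
theorem cyc_add_of_pos {j : ℕ} (σ : Fin (j + 1) → Bool) {q : ℕ} (hq : 0 < q) :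
    cyc σ (q + j) = cyc σ (q - 1) := by
  rw [← cyc_add_length σ (q - 1)]
  congr 1
  omega

/-- Every index at which a run of `+` begins is the start of a cluster. -/
theorem exists_isCluster {i : ℕ} {σ : Fin (i + 2) → Bool} {q : ℕ} (hq : q ≤ i + 1)
    (h1 : cyc σ q = true) (h2 : cyc σ (q + (i + 1)) = false) : ∃ r, IsCluster σ q r := by
  have hex : ∃ k, cyc σ (q + k + 1) = false := ⟨i, h2⟩
  classical
  refine ⟨q + Nat.find hex, by omega, ?_, hq, ?_, h2, Nat.find_spec hex⟩
  · have : Nat.find hex ≤ i := Nat.find_min' hex h2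
    omega
  · intro u hu1 hu2
    rcases Nat.eq_or_lt_of_le hu1 with rfl | hlt
    · exact h1
    · have := Nat.find_min hex (m := u - q - 1) (by omega)
      rw [show q + (u - q - 1) + 1 = u by omega] at this
      simpa using this

theorem IsCluster.right_unique {j : ℕ} {σ : Fin (j + 1) → Bool} {q r r' : ℕ}
    (h : IsCluster σ q r) (h' : IsCluster σ q r') : r = r' := by
  obtain ⟨a1, -, -, a2, -, a3⟩ := h
  obtain ⟨b1, -, -, b2, -, b3⟩ := h'
  rcases lt_trichotomy r r' with hlt | heq | hlt
  · simp [b2 (r + 1) (by omega) (by omega)] at a3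
  · exact heq
  · simp [a2 (r' + 1) (by omega) (by omega)] at b3

/-- The starting index of the initial cluster. -/
noncomputable def iniStart {i : ℕ} (σ : Fin (i + 2) → Bool) : ℕ :=
  sInf {q | ∃ r, IsCluster σ q r}

theorem IsIni.iniStart_eq {i : ℕ} {σ : Fin (i + 2) → Bool} {l r : ℕ} (h : IsIni σ l r) :
    iniStart σ = l :=
  le_antisymm (Nat.sInf_le ⟨r, h.1⟩)
    (le_csInf ⟨l, r, h.1⟩ fun _ ⟨r', hr'⟩ => h.2 _ r' hr')

theorem iniStart_le {i : ℕ} {σ : Fin (i + 2) → Bool} {q : ℕ} (hq : q ≤ i + 1)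
    (h1 : cyc σ q = true) (h2 : cyc σ (q + (i + 1)) = false) : iniStart σ ≤ q :=
  Nat.sInf_le (exists_isCluster hq h1 h2)

theorem cyc_insertPlus_deleteEntry {i : ℕ} (σ : Fin (i + 2) → Bool) {pos p u : ℕ}
    (hp : p ≤ i + 1) (hu : u ≤ i + 1) :
    cyc (insertPlus (deleteEntry σ pos) p) u =
      if u < p then (if u < pos then cyc σ u else cyc σ (u + 1))
      else if u = p then true
      else if u - 1 < pos then cyc σ (u - 1) else cyc σ u := by
  rw [cyc_of_lt _ (show u < i + 1 + 1 by omega)]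
  unfold insertPlus deleteEntry
  dsimp only
  split_ifs <;> first
    | rfl
    | omega
    | (rw [cyc_of_lt _ (by omega)]; done)
    | (rw [cyc_of_lt _ (by omega)]; congr 2; omega)

theorem plusCount_eq_sum {i : ℕ} (σ : Fin (i + 2) → Bool) :
    plusCount σ = ∑ u, if σ u = true then 1 else 0 :=
  Finset.card_filter _ _

theorem deleteEntry_eq {j : ℕ} (σ : Fin (j + 2) → Bool) (p : Fin (j + 2)) (u : Fin (j + 1)) :
    deleteEntry σ p u = σ (p.succAbove u) := by
  unfold deleteEntry Fin.succAbove
  simp only [Fin.lt_def, Fin.val_castSucc]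
  split_ifs <;> rfl

theorem insertPlus_self {m : ℕ} (c : Fin (m + 1) → Bool) (p : Fin (m + 2)) :
    insertPlus c p p = true := by
  simp [insertPlus]

theorem insertPlus_succAbove {m : ℕ} (c : Fin (m + 1) → Bool) (p : Fin (m + 2))
    (u : Fin (m + 1)) : insertPlus c p (p.succAbove u) = c u := by
  unfold insertPlus Fin.succAbove
  simp only [Fin.lt_def, Fin.val_castSucc]
  have := u.isLt
  split_ifs <;> simp_all <;> omega

/-- Replacing the entry at `pos` by a `+` elsewhere adds one `+` if the entry was `−`. -/
theorem plusCount_insertPlus_deleteEntry {i : ℕ} (σ : Fin (i + 2) → Bool) {pos p : ℕ}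
    (hpos : pos < i + 2) (hp : p < i + 2) :
    plusCount (insertPlus (deleteEntry σ pos) p) + (if σ ⟨pos, hpos⟩ = true then 1 else 0) =
      plusCount σ + 1 := by
  lift pos to Fin (i + 2) using hpos
  lift p to Fin (i + 2) using hp
  rw [plusCount_eq_sum, plusCount_eq_sum, Fin.sum_univ_succAbove _ p,
    Fin.sum_univ_succAbove (fun u => if σ u = true then 1 else 0) pos]
  simp only [insertPlus_self, insertPlus_succAbove, deleteEntry_eq, Fin.eta, if_true]
  omega

/-- Every transformation is weakly increasing for this rank: count of `+`-s first, then
earlier start of the initial cluster, then the lexicographic order on sequences. -/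
noncomputable def seqRank {i : ℕ} (σ : Fin (i + 2) → Bool) :
    ℕ ×ₗ (ℕᵒᵈ ×ₗ Lex (Fin (i + 2) → Bool)) :=
  toLex (plusCount σ, toLex (OrderDual.toDual (iniStart σ), toLex σ))

theorem seqRank_injective {i : ℕ} : Function.Injective (@seqRank i) := by
  intro σ τ h
  simpa [seqRank] using (congrArg (fun x => (ofLex (ofLex x).2).2) h)

theorem seqRank_lt_of_plusCount_lt {i : ℕ} {σ τ : Fin (i + 2) → Bool}
    (h : plusCount σ < plusCount τ) : seqRank σ < seqRank τ :=
  Prod.Lex.toLex_lt_toLex.2 (Or.inl h)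

theorem seqRank_lt_of_iniStart_lt {i : ℕ} {σ τ : Fin (i + 2) → Bool}
    (h : plusCount σ = plusCount τ) (hl : iniStart τ < iniStart σ) : seqRank σ < seqRank τ :=
  Prod.Lex.toLex_lt_toLex.2
    (Or.inr ⟨h, Prod.Lex.toLex_lt_toLex.2 (Or.inl (OrderDual.toDual_lt_toDual.2 hl))⟩)

theorem seqRank_lt_of_lex_lt {i : ℕ} {σ τ : Fin (i + 2) → Bool}
    (h : plusCount σ = plusCount τ) (hl : iniStart τ ≤ iniStart σ) (hlex : toLex σ < toLex τ) :
    seqRank σ < seqRank τ := by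
  rcases hl.lt_or_eq with hlt | heq
  · exact seqRank_lt_of_iniStart_lt h hlt
  · exact Prod.Lex.toLex_lt_toLex.2
      (Or.inr ⟨h, Prod.Lex.toLex_lt_toLex.2 (Or.inr ⟨congrArg OrderDual.toDual heq.symm, hlex⟩)⟩)

/-- The rank increases when a `+` of a non-initial cluster is moved to the end of the
initial cluster. -/
theorem seqRank_lt_of_delete_plus {i : ℕ} {σ : Fin (i + 2) → Bool} {d q r' l r : ℕ}
    (hc : IsCluster σ q r') (hni : ¬ IsIni σ q r') (hini : IsIni σ l r)
    (hqd : q ≤ d) (hdr : d ≤ r') (hd : d ≠ i + 2) :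
    seqRank σ <
      seqRank (insertPlus (deleteEntry σ (d % (i + 2)))
        (delMap (d % (i + 2)) (r % (i + 2)) + 1)) := by
  have hstart := hini.iniStart_eq
  have hlq : l < q := by
    refine lt_of_le_of_ne (hini.2 q r' hc) ?_
    rintro rfl
    exact hni (hini.1.right_unique hc ▸ hini)
  obtain ⟨⟨hlr, -, -, hlplus, hlminus, hrminus⟩, -⟩ := hini
  obtain ⟨-, hr', hq, hqplus, hqminus, -⟩ := hc
  have hrq : r + 1 < q := by
    rw [cyc_add_of_pos σ (by omega)] at hqminus
    by_contra! hcon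
    simp [hlplus (q - 1) (by omega) (by omega)] at hqminus
  rw [Nat.mod_eq_of_lt (show r < i + 2 by omega)]
  have hdplus := hqplus d hqd hdr
  have hposlt : d % (i + 2) < i + 2 := Nat.mod_lt _ (by omega)
  have hposplus : σ ⟨d % (i + 2), hposlt⟩ = true := hdplus
  have hcount : ∀ p, p < i + 2 →
      plusCount σ = plusCount (insertPlus (deleteEntry σ (d % (i + 2))) p) := by
    intro p hp
    have := plusCount_insertPlus_deleteEntry σ hposlt hp
    rw [if_pos hposplus] at this
    omega
  rcases lt_or_ge d (i + 2) with hlt | hge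
  · rw [Nat.mod_eq_of_lt hlt] at hcount ⊢
    rw [show delMap d r = r from if_pos (by omega)]
    have hval := fun u => cyc_insertPlus_deleteEntry σ (pos := d) (p := r + 1) (u := u) (by omega)
    refine seqRank_lt_of_lex_lt (hcount _ (by omega)) ?_ ?_
    · rw [hstart]
      refine iniStart_le (by omega) ?_ ?_
      · rw [hval l (by omega), if_pos (by omega), if_pos (by omega)]
        exact hlplus l le_rfl hlr
      · rcases Nat.eq_zero_or_pos l with rfl | hl
        · rw [zero_add] at hlminus ⊢
          have : d ≠ i + 1 := by
            rintro rfl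
            simp [hdplus] at hlminus
          rw [hval _ le_rfl, if_neg (by omega), if_neg (by omega), if_neg (by omega)]
          exact hlminus
        · rw [cyc_add_of_pos _ hl] at hlminus ⊢
          rw [hval _ (by omega), if_pos (by omega), if_pos (by omega)]
          exact hlminus
    · refine ⟨⟨r + 1, by omega⟩, ?_, ?_⟩
      · intro u hu
        have hu' : (u : ℕ) < r + 1 := hu
        have := hval u (by omega)
        rw [if_pos hu', if_pos (by omega), cyc_of_lt _ u.isLt, cyc_of_lt _ u.isLt] at this
        exact this.symm
      · have h1 := hval (r + 1) (by omega)
        rw [if_neg (by omega), if_pos rfl, cyc_of_lt _ (by omega)] at h1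
        rw [cyc_of_lt _ (by omega)] at hrminus
        change σ _ < insertPlus _ _ _
        rw [h1, hrminus]
        decide
  · have hmod : d % (i + 2) = d - (i + 2) := by
      rw [Nat.mod_eq_sub_mod hge, Nat.mod_eq_of_lt (by omega)]
    rw [hmod] at hcount ⊢
    have hposl : d - (i + 2) + 1 < l := by
      by_contra! hcon
      rw [hqplus (l + (i + 1)) (by omega) (by omega)] at hlminus
      cases hlminus
    rw [show delMap (d - (i + 2)) r + 1 = r by unfold delMap; split_ifs <;> omega]
    have hval := fun u => cyc_insertPlus_deleteEntry σ (pos := d - (i + 2)) (p := r) (u := u)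
      (by omega)
    refine seqRank_lt_of_iniStart_lt (hcount _ (by omega)) ?_
    rw [hstart]
    refine lt_of_le_of_lt (b := l - 1) (iniStart_le (by omega) ?_ ?_) (by omega)
    · rw [hval _ (by omega), if_pos (by omega), if_neg (by omega), Nat.sub_add_cancel (by omega)]
      exact hlplus l le_rfl hlr
    · rw [cyc_add_of_pos _ (by omega)] at hlminus ⊢
      rw [hval _ (by omega), if_pos (by omega), if_neg (by omega), Nat.sub_add_cancel (by omega)]
      exact hlminus

theorem IsTransf.seqRank_le {i : ℕ} {σ τ : Fin (i + 2) → Bool} (h : IsTransf σ τ) :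
    seqRank σ ≤ seqRank τ := by
  rcases h with ⟨rfl, rfl⟩ | ⟨pos, l, r, hcontr, hini, rfl⟩
  · exact le_rfl
  · rcases hcontr with ⟨hpos, hminus⟩ | ⟨d, q, r', rfl, hc, hni, -, -, hqd, hdr, -, -, hd⟩ |
      ⟨d, r', rfl, hc, hni, -, hqd, hdr, hd⟩
    · refine (seqRank_lt_of_plusCount_lt ?_).le
      have hr : r % (i + 2) < i + 2 := Nat.mod_lt _ (by omega)
      have := plusCount_insertPlus_deleteEntry σ hpos (p := delMap pos (r % (i + 2)) + 1)
        (by unfold delMap; split_ifs <;> omega)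
      rw [if_neg (by simp [hminus])] at this
      omega
    · exact (seqRank_lt_of_delete_plus hc hni hini hqd hdr hd).le
    · exact (seqRank_lt_of_delete_plus hc hni hini hqd hdr hd).le

theorem seqRank_le_of_reflTransGen {i : ℕ} {σ τ : Fin (i + 2) → Bool}
    (h : Relation.ReflTransGen IsTransf σ τ) : seqRank σ ≤ seqRank τ := by
  induction h with
  | refl => exact le_rfl
  | tail _ hstep ih => exact ih.trans hstep.seqRank_le

theorem SeqPreceq.seqRank_le {i : ℕ} {σ τ : Fin (i + 2) → Bool} (h : SeqPreceq σ τ) :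
    seqRank σ ≤ seqRank τ :=
  h.elim (fun hlt => (seqRank_lt_of_plusCount_lt hlt).le)
    fun heq => seqRank_le_of_reflTransGen heq.2

/-- Lemma `order`.  `⪯` is a partial order on the set of
`i`-sequences: it is reflexive, transitive and antisymmetric. -/
theorem seqPreceq_is_partial_order (i : ℕ) :
    Reflexive (@SeqPreceq i) ∧ Transitive (@SeqPreceq i) ∧
      AntiSymmetric (@SeqPreceq i) := by
  refine ⟨fun σ => Or.inr ⟨rfl, .refl⟩, ?_, fun σ τ h1 h2 =>
    seqRank_injective (le_antisymm h1.seqRank_le h2.seqRank_le)⟩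
  rintro σ τ ρ (h1 | ⟨h1, g1⟩) (h2 | ⟨h2, g2⟩)
  · exact Or.inl (h1.trans h2)
  · exact Or.inl (h2 ▸ h1)
  · exact Or.inl (h1 ▸ h2)
  · exact Or.inr ⟨h1.trans h2, g1.trans g2⟩
end

section
/- Let D, D′ ⊆ ℝⁿ be pointed rational finite-polyhedral cones with D \ {0} ⊆ int(D′), let deg : ℝⁿ → ℝ be a linear functional with deg(x) > 0 for all x ∈ D′ \ {0}, let m₀ be a nonzero element of D′ ∩ ℤⁿ, and let c be a natural number. Then there exists γ ∈ ℝ such that every m ∈ D ∩ ℤⁿ with deg(m) > γ satisfies m − c·m₀ ∈ D′. Consequently, for any fixed vector t ∈ ℝⁿ the same conclusion holds for translated lattice points: there exists γ such that every m ∈ (t + D) ∩ ℤⁿ with deg(m) > γ satisfies m − c·m₀ ∈ t + D′. -/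
/-! # Statement 8

A lattice-point displacement lemma for rational polyhedral cones (used in Lemma
`divis` of Gubeladze, "The nilpotence conjecture in K-theory of toric varieties").
-/

/-- The real point of `ℝⁿ` associated with an integral point of `ℤⁿ`. -/
def zr {n : ℕ} (m : Fin n → ℤ) : Fin n → ℝ := fun i => (m i : ℝ)

/-- A rational (pointed, finite-polyhedral) cone, described as the set of nonnegative
real combinations of a finite set of integral points (equivalently, for pointed cones,
an intersection of finitely many rational closed half-spaces through the origin). -/
def IsRatPolyCone {n : ℕ} (C : Set (Fin n → ℝ)) : Prop :=
  ∃ s : Finset (Fin n → ℤ),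
    C = {x | ∃ c : (Fin n → ℤ) → ℝ, (∀ v, 0 ≤ c v) ∧ x = ∑ v ∈ s, c v • zr v}

/-- A cone is pointed if it contains no affine line, i.e. no pair `{x, -x}` with `x ≠ 0`. -/
def IsPointedCone {n : ℕ} (C : Set (Fin n → ℝ)) : Prop :=
  ∀ x ∈ C, -x ∈ C → x = 0

open Topology in
/-- From a point of the relative interior of `C` one can move a little in the direction `-w`, for
`w ∈ C`, without leaving `C`, provided `0 ∈ C`. -/
theorem exists_pos_sub_smul_mem_of_mem_intrinsicInterior {E : Type*} [NormedAddCommGroup E]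
    [NormedSpace ℝ E] {C : Set E} {v w : E} (hv : v ∈ intrinsicInterior ℝ C) (hw : w ∈ C)
    (h0 : (0 : E) ∈ C) : ∃ ε : ℝ, 0 < ε ∧ v - ε • w ∈ C := by
  obtain ⟨⟨v, hvs⟩, hint, rfl⟩ := hv
  have hmem (ε : ℝ) : v - ε • w ∈ affineSpan ℝ C := by
    convert (affineSpan ℝ C).smul_vsub_vadd_mem ε (subset_affineSpan ℝ C h0)
      (subset_affineSpan ℝ C hw) hvs using 1
    simp [sub_eq_neg_add]
  let f : ℝ → affineSpan ℝ C := fun ε => ⟨v - ε • w, hmem ε⟩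
  have hf : Continuous f := by fun_prop
  have hf0 : f 0 = ⟨v, hvs⟩ := by simp [f]
  have hnhds : ∀ᶠ ε in 𝓝 (0 : ℝ), f ε ∈ interior ((↑) ⁻¹' C : Set (affineSpan ℝ C)) :=
    hf.continuousAt.eventually_mem (hf0 ▸ isOpen_interior.mem_nhds hint)
  obtain ⟨ε, hε, hpos⟩ :=
    ((hnhds.filter_mono nhdsWithin_le_nhds).and (self_mem_nhdsWithin (s := Set.Ioi 0))).exists
  exact ⟨ε, hpos, interior_subset (s := ((↑) : affineSpan ℝ C → E) ⁻¹' C) hε⟩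

namespace IsRatPolyCone

variable {n : ℕ} {C : Set (Fin n → ℝ)}

theorem zero_mem (hC : IsRatPolyCone C) : (0 : Fin n → ℝ) ∈ C := by
  obtain ⟨s, rfl⟩ := hC
  exact ⟨0, by simp, by simp⟩

theorem add_mem (hC : IsRatPolyCone C) {x y : Fin n → ℝ} (hx : x ∈ C) (hy : y ∈ C) :
    x + y ∈ C := by
  obtain ⟨s, rfl⟩ := hC
  obtain ⟨a, ha, rfl⟩ := hx
  obtain ⟨b, hb, rfl⟩ := hy
  exact ⟨a + b, fun v => add_nonneg (ha v) (hb v), by simp [add_smul, Finset.sum_add_distrib]⟩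

theorem smul_mem (hC : IsRatPolyCone C) {r : ℝ} (hr : 0 ≤ r) {x : Fin n → ℝ} (hx : x ∈ C) :
    r • x ∈ C := by
  obtain ⟨s, rfl⟩ := hC
  obtain ⟨a, ha, rfl⟩ := hx
  exact ⟨r • a, fun v => mul_nonneg hr (ha v), by simp [Finset.smul_sum, mul_smul]⟩

theorem sum_mem (hC : IsRatPolyCone C) {ι : Type*} {s : Finset ι} {x : ι → Fin n → ℝ}
    (hx : ∀ i ∈ s, x i ∈ C) : ∑ i ∈ s, x i ∈ C :=
  Finset.sum_induction x (· ∈ C) (fun _ _ => hC.add_mem) hC.zero_mem hx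

/-- If `D \ {0}` lies in the relative interior of `C` and `w ∈ C`, then some multiple of the
identity dominates the rank-one map `deg (·) • w` on `D`, in the order defined by `C`. -/
theorem exists_pos_smul_sub_mem {D : Set (Fin n → ℝ)} (hD : IsRatPolyCone D)
    (hC : IsRatPolyCone C) (hDC : D \ {0} ⊆ intrinsicInterior ℝ C)
    (deg : (Fin n → ℝ) →ₗ[ℝ] ℝ) {w : Fin n → ℝ} (hw : w ∈ C) :
    ∃ K : ℝ, 0 < K ∧ ∀ d ∈ D, K • d - deg d • w ∈ C := by
  have hsub : D ⊆ C := fun x hx => by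
    by_cases h : x = 0
    · exact h ▸ hC.zero_mem
    · exact intrinsicInterior_subset (hDC ⟨hx, h⟩)
  have hpoint : ∀ x ∈ D, ∃ k : ℝ, 0 ≤ k ∧ k • x - deg x • w ∈ C := by
    intro x hx
    by_cases h : x = 0
    · exact ⟨0, le_rfl, by simpa [h] using hC.zero_mem⟩
    obtain ⟨ε, hε, hmem⟩ :=
      exists_pos_sub_smul_mem_of_mem_intrinsicInterior (hDC ⟨hx, h⟩) hw hC.zero_mem
    refine ⟨|deg x| / ε, by positivity, ?_⟩
    have hsum := hC.add_mem (hC.smul_mem (r := |deg x| / ε) (by positivity) hmem)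
      (hC.smul_mem (sub_nonneg.2 (le_abs_self (deg x))) hw)
    convert hsum using 1
    rw [smul_sub, smul_smul, div_mul_cancel₀ _ hε.ne']
    module
  choose! k hk hkmem using hpoint
  obtain ⟨s, hs⟩ := hD
  have hgen : ∀ v ∈ s, zr v ∈ D := fun v hv => by
    rw [hs]
    exact ⟨Pi.single v 1, fun u => by rw [Pi.single_apply]; positivity,
      by simp [Pi.single_apply, hv]⟩
  have hnonneg : ∀ v ∈ s, 0 ≤ k (zr v) := fun v hv => hk _ (hgen v hv)
  set K := ∑ v ∈ s, k (zr v) + 1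
  have hKgen : ∀ v ∈ s, K • zr v - deg (zr v) • w ∈ C := fun v hv => by
    have hle : k (zr v) ≤ K := by
      linarith [Finset.single_le_sum hnonneg hv]
    have hsum := hC.add_mem (hkmem _ (hgen v hv))
      (hC.smul_mem (sub_nonneg.2 hle) (hsub (hgen v hv)))
    convert hsum using 1
    module
  refine ⟨K, by linarith [Finset.sum_nonneg hnonneg], fun d hd => ?_⟩
  rw [hs] at hd
  obtain ⟨a, ha, rfl⟩ := hd
  convert hC.sum_mem fun v hv => hC.smul_mem (ha v) (hKgen v hv) using 1
  simp only [map_sum, map_smul, Finset.smul_sum, Finset.sum_smul, ← Finset.sum_sub_distrib]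
  refine Finset.sum_congr rfl fun v _ => ?_
  module

end IsRatPolyCone

/-- Let `D, D′ ⊆ ℝⁿ` be pointed rational finite-polyhedral cones with
`D \ {0} ⊆ int D′` (relative interior), let `deg` be a linear functional positive on
`D′ \ {0}`, let `m₀ ∈ D′ ∩ ℤⁿ` be nonzero and `c ∈ ℕ`.  Then there is `γ ∈ ℝ` such that
every `m ∈ D ∩ ℤⁿ` with `deg m > γ` satisfies `m − c·m₀ ∈ D′`; and likewise, for every
fixed `t ∈ ℝⁿ` there is `γ` such that every `m ∈ (t + D) ∩ ℤⁿ` with `deg m > γ`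
satisfies `m − c·m₀ ∈ t + D′`. -/
theorem lattice_points_deep_in_cone
    {n : ℕ} (D D' : Set (Fin n → ℝ))
    (hD : IsRatPolyCone D) (hD' : IsRatPolyCone D')
    (hDp : IsPointedCone D) (hD'p : IsPointedCone D')
    (hDD' : D \ {0} ⊆ intrinsicInterior ℝ D')
    (deg : (Fin n → ℝ) →ₗ[ℝ] ℝ) (hdeg : ∀ x ∈ D', x ≠ 0 → 0 < deg x)
    (m₀ : Fin n → ℤ) (hm₀ : zr m₀ ∈ D') (hm₀0 : m₀ ≠ 0)
    (c : ℕ) :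
    (∃ γ : ℝ, ∀ m : Fin n → ℤ, zr m ∈ D → γ < deg (zr m) →
        zr m - (c : ℝ) • zr m₀ ∈ D') ∧
    (∀ t : Fin n → ℝ, ∃ γ : ℝ, ∀ m : Fin n → ℤ,
        (∃ d ∈ D, zr m = t + d) → γ < deg (zr m) →
        ∃ d' ∈ D', zr m - (c : ℝ) • zr m₀ = t + d') := by
  obtain ⟨K, hK, hKD⟩ := hD.exists_pos_smul_sub_mem hD' hDD' deg hm₀
  have key : ∀ d ∈ D, K * c < deg d → d - (c : ℝ) • zr m₀ ∈ D' := by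
    intro d hd hlt
    have hc : 0 ≤ K⁻¹ * (deg d - K * c) := mul_nonneg (by positivity) (by linarith)
    convert hD'.add_mem (hD'.smul_mem (inv_nonneg.2 hK.le) (hKD d hd))
      (hD'.smul_mem hc hm₀) using 1
    rw [mul_sub, inv_mul_cancel_left₀ hK.ne', smul_sub, inv_smul_smul₀ hK.ne']
    module
  refine ⟨⟨K * c, fun m => key _⟩, fun t => ⟨K * c + deg t, ?_⟩⟩
  rintro m ⟨d, hd, hm⟩ hlt
  rw [hm, map_add] at hlt
  exact ⟨_, key d hd (by linarith), by rw [hm, add_sub_assoc]⟩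
end
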